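/- arXiv:1604.00803 — 4 statements merged into one kernel-verified Lean document; each statement's English description precedes it below -/
import Mathlib

section
/- Let r, s be positive integers, let l = min(r, s) and m = max(r, s). Then, as an identity of formal power series over ℚ, the generating function of plane partitions fitting inside an r × s rectangle satisfies Σ_{n≥0} PP(n; r, s)·x^n = Π_{j=l}^{m} (1 − x^j)^{−l} · Π_{i=1}^{l−1} (1 − x^i)^{−i} · (1 − x^{m+i})^{−(l−i)}. -/
/-- `PP n r s` : number of plane partitions of `n` fitting inside an `r × s` rectangle,
i.e. functions `f : Fin r × Fin s → ℕ` with total sum `n` that are weakly decreasing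
in each coordinate. -/
noncomputable def PP (n r s : ℕ) : ℕ :=
  Nat.card {f : Fin r × Fin s → ℕ //
    (∑ p, f p) = n ∧
    ∀ p q : Fin r × Fin s, p.1 ≤ q.1 → p.2 ≤ q.2 → f q ≤ f p}

namespace PPaux

/-- Interlacing of two sequences. -/
def Inter (l m : ℕ →₀ ℕ) : Prop := ∀ k, m k ≤ l k ∧ l (k + 1) ≤ m k

/-- Size of a partition. -/
def sz (p : ℕ →₀ ℕ) : ℕ := p.sum fun _ x => x

theorem sz_eq (p : ℕ →₀ ℕ) (N : ℕ) (h : ∀ k, N ≤ k → p k = 0) :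
    sz p = ∑ k ∈ Finset.range N, p k := by
  unfold sz
  apply Finsupp.sum_of_support_subset
  · intro k hk
    rw [Finset.mem_range]
    by_contra hc
    exact (Finsupp.mem_support_iff.1 hk) (h k (by omega))
  · simp

theorem exists_bd (p : ℕ →₀ ℕ) : ∃ N, ∀ k, N ≤ k → p k = 0 := by
  refine ⟨p.support.sup id + 1, fun k hk => ?_⟩
  by_contra hc
  have := Finset.le_sup (f := id) (Finsupp.mem_support_iff.2 hc)
  simp only [id] at this
  omega

@[simp] theorem sz_zero : sz 0 = 0 := by simp [sz]

theorem inter_zero {m : ℕ →₀ ℕ} (h : Inter 0 m) : m = 0 := by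
  ext k
  have := (h k).1
  simpa using this

theorem up_supp (μ : ℕ →₀ ℕ) (f : ℕ → ℕ) (h : ∀ k, f (k + 1) ≤ μ k) (k : ℕ) (hk : f k ≠ 0) :
    k ∈ insert 0 (μ.support.map (addRightEmbedding 1)) := by
  cases k with
  | zero => simp
  | succ k =>
    have := h k
    simp
    omega

theorem dn_supp (μ : ℕ →₀ ℕ) (f : ℕ → ℕ) (h : ∀ k, f k ≤ μ k) (k : ℕ) (hk : f k ≠ 0) :
    k ∈ μ.support := by
  have := h k
  simp
  omega

/-- Values of the lower partition. -/
def dnFun (μ ν l : ℕ → ℕ) (k : ℕ) : ℕ :=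
  min (μ k) (ν k) + max (μ (k + 1)) (ν (k + 1)) - l (k + 1)

/-- Values of the upper partition. -/
def upFun (μ ν κ : ℕ → ℕ) (a : ℕ) : ℕ → ℕ
  | 0 => max (μ 0) (ν 0) + a
  | k + 1 => min (μ k) (ν k) + max (μ (k + 1)) (ν (k + 1)) - κ k

/-- The local rule. -/
noncomputable def loc (μ ν : ℕ →₀ ℕ) :
    {l // Inter l μ ∧ Inter l ν} ≃ {κ // Inter μ κ ∧ Inter ν κ} × ℕ where
  toFun l := (⟨Finsupp.onFinset μ.support (dnFun μ ν l.1) (dn_supp μ _ (by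
      intro k
      have h1 := l.2.1 k
      have h2 := l.2.2 k
      have h3 := l.2.1 (k + 1)
      have h4 := l.2.2 (k + 1)
      unfold dnFun
      omega)), by
      constructor <;> intro k <;>
      · have h1 := l.2.1 k
        have h2 := l.2.2 k
        have h3 := l.2.1 (k + 1)
        have h4 := l.2.2 (k + 1)
        simp only [Finsupp.onFinset_apply]
        unfold dnFun
        omega⟩, l.1 0 - max (μ 0) (ν 0))
  invFun x := ⟨Finsupp.onFinset _ (upFun μ ν x.1.1 x.2) (up_supp μ _ (by
      intro k
      have h1 := x.1.2.1 k
      have h2 := x.1.2.2 k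
      simp only [upFun]
      omega)), by
      constructor <;> intro k <;> cases k with
      | zero =>
        have h1 := x.1.2.1 0
        have h2 := x.1.2.2 0
        simp only [Finsupp.onFinset_apply, upFun]
        omega
      | succ k =>
        have h1 := x.1.2.1 (k + 1)
        have h2 := x.1.2.2 (k + 1)
        have h3 := x.1.2.1 k
        have h4 := x.1.2.2 k
        simp only [Finsupp.onFinset_apply, upFun]
        omega⟩
  left_inv l := by
    apply Subtype.ext
    ext k
    cases k with
    | zero =>
      have h1 := l.2.1 0
      have h2 := l.2.2 0
      simp only [Finsupp.onFinset_apply, upFun]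
      omega
    | succ k =>
      have h1 := l.2.1 k
      have h2 := l.2.2 k
      have h3 := l.2.1 (k + 1)
      have h4 := l.2.2 (k + 1)
      simp only [Finsupp.onFinset_apply, upFun, dnFun]
      omega
  right_inv x := by
    apply Prod.ext
    · apply Subtype.ext
      ext k
      have h1 := x.1.2.1 k
      have h2 := x.1.2.2 k
      simp only [Finsupp.onFinset_apply, upFun, dnFun]
      omega
    · simp only [Finsupp.onFinset_apply, upFun]
      omega

theorem loc_sz (μ ν : ℕ →₀ ℕ) (l) :
    sz l.1 + sz (loc μ ν l).1.1 = sz μ + sz ν + (loc μ ν l).2 := by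
  obtain ⟨N1, hN1⟩ := exists_bd μ
  obtain ⟨N2, hN2⟩ := exists_bd ν
  obtain ⟨N, hN⟩ : ∃ N, N = N1 + N2 := ⟨_, rfl⟩
  have hl : ∀ k, N + 1 ≤ k → l.1 k = 0 := by
    intro k hk
    obtain ⟨k, rfl⟩ : ∃ m, k = m + 1 := ⟨k - 1, by omega⟩
    have := (l.2.1 k).2
    have := hN1 k (by omega)
    omega
  have hk : ∀ k, N ≤ k → (loc μ ν l).1.1 k = 0 := by
    intro k hk
    have := ((loc μ ν l).1.2.1 k).1
    have := hN1 k (by omega)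
    omega
  rw [sz_eq l.1 (N + 1) hl, sz_eq _ N hk, sz_eq μ (N + 1) (fun k h => hN1 k (by omega)),
    sz_eq ν (N + 1) (fun k h => hN2 k (by omega)), ← Finset.sum_add_distrib]
  have h0 : (loc μ ν l).2 = l.1 0 - max (μ 0) (ν 0) := rfl
  have hs : ∀ k, (loc μ ν l).1.1 k = 
    min (μ k) (ν k) + max (μ (k + 1)) (ν (k + 1)) - l.1 (k + 1) := fun k => rfl
  have e1 : ∑ k ∈ Finset.range (N + 1), (μ k + ν k) =
      ∑ k ∈ Finset.range (N + 1), max (μ k) (ν k) + ∑ k ∈ Finset.range (N + 1), min (μ k) (ν k) := by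
    rw [← Finset.sum_add_distrib]
    exact Finset.sum_congr rfl fun k _ => by omega
  rw [e1, Finset.sum_range_succ', Finset.sum_range_succ' (fun k => max (μ k) (ν k)),
    Finset.sum_range_succ (fun k => min (μ k) (ν k)), hN1 N (by omega), hN2 N (by omega)]
  have e2 : ∑ k ∈ Finset.range N, l.1 (k + 1) + ∑ k ∈ Finset.range N, (loc μ ν l).1.1 k =
     ∑ k ∈ Finset.range N, max (μ (k + 1)) (ν (k + 1)) + ∑ k ∈ Finset.range N, min (μ k) (ν k) := by
    rw [← Finset.sum_add_distrib, ← Finset.sum_add_distrib]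
    refine Finset.sum_congr rfl fun k _ => ?_
    rw [hs]
    have h1 := l.2.1 k
    have h2 := l.2.2 k
    have h3 := l.2.1 (k + 1)
    have h4 := l.2.2 (k + 1)
    omega
  have h1 := l.2.1 0
  have h2 := l.2.2 0
  rw [h0]
  omega

/-- Chains of interlacing partitions, from `l` down to zero in `s` steps. -/
def Chain (s : ℕ) (l : ℕ →₀ ℕ) : Type :=
  {D : ℕ → (ℕ →₀ ℕ) // D 0 = l ∧ D s = 0 ∧ ∀ j, Inter (D j) (D (j + 1))}

/-- Total size of a chain, without the top. -/
def etot {s : ℕ} {l : ℕ →₀ ℕ} (c : Chain s l) : ℕ := ∑ j ∈ Finset.range s, sz (c.1 (j + 1))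

/-- Peeling the top of a chain. -/
def chainSucc (s : ℕ) (l : ℕ →₀ ℕ) :
    Chain (s + 1) l ≃ Σ ν : {ν // Inter l ν}, Chain s ν.1 where
  toFun D := ⟨⟨D.1 1, by have := D.2.2.2 0; rwa [D.2.1] at this⟩,
    ⟨fun j => D.1 (j + 1), rfl, D.2.2.1, fun j => D.2.2.2 (j + 1)⟩⟩
  invFun x := ⟨fun j => Nat.casesOn j l x.2.1, rfl, x.2.2.2.1, by
    intro j
    cases j with
    | zero => have := x.1.2; simpa [x.2.2.1] using this
    | succ j => exact x.2.2.2.2 j⟩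
  left_inv D := by
    apply Subtype.ext
    funext j
    cases j with
    | zero => exact D.2.1.symm
    | succ j => rfl
  right_inv x := by
    obtain ⟨⟨ν, h⟩, ⟨D, h1, h2⟩⟩ := x
    change D 0 = ν at h1
    cases h1
    rfl

theorem etot_chainSucc (s : ℕ) (l : ℕ →₀ ℕ) (c : Chain (s + 1) l) :
    etot c = sz (chainSucc s l c).1.1 + etot (chainSucc s l c).2 := by
  unfold etot
  rw [Finset.sum_range_succ', add_comm]
  rfl

theorem etot_symm (s : ℕ) (l : ℕ →₀ ℕ) (x : Σ ν : {ν // Inter l ν}, Chain s ν.1) :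
    etot ((chainSucc s l).symm x) = sz x.1.1 + etot x.2 := by
  rw [etot_chainSucc, Equiv.apply_symm_apply]

theorem chain_zero {l : ℕ →₀ ℕ} (c : Chain 0 l) : l = 0 := by
  rw [← c.2.1]; exact c.2.2.1

theorem chain_all_zero {s : ℕ} {D : ℕ → (ℕ →₀ ℕ)} (h : D s = 0)
    (hi : ∀ j, Inter (D j) (D (j + 1))) (j : ℕ) (hj : s ≤ j) : D j = 0 := by
  induction j, hj using Nat.le_induction with
  | base => exact h
  | succ j _ ih =>
    have := hi j
    rw [ih] at this
    exact inter_zero this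

instance (l : ℕ →₀ ℕ) : Subsingleton (Chain 0 l) := ⟨fun a b => by
  apply Subtype.ext
  funext j
  rw [chain_all_zero a.2.2.1 a.2.2.2 j (by omega), chain_all_zero b.2.2.1 b.2.2.2 j (by omega)]⟩

/-- The zero chain. -/
def zChain (s : ℕ) (l : ℕ →₀ ℕ) (h : l = 0) : Chain s l :=
  ⟨fun _ => 0, h.symm, rfl, fun j k => by simp⟩

/-- Adding an entry in front of a vector. -/
def consE (s : ℕ) (α : Type) : (Fin s → α) × α ≃ (Fin (s + 1) → α) where
  toFun x := Fin.cons x.2 x.1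
  invFun y := (Fin.tail y, y 0)
  left_inv x := by simp
  right_inv y := by simp

theorem consE_zero (s : ℕ) (α : Type) (x : (Fin s → α) × α) : consE s α x 0 = x.2 := rfl

theorem consE_succ (s : ℕ) (α : Type) (x : (Fin s → α) × α) (i : Fin s) :
    consE s α x i.succ = x.1 i := rfl

theorem row (s : ℕ) : ∀ μ : ℕ →₀ ℕ,
    ∃ e : (Σ l : {l // Inter l μ}, Chain s l.1) ≃ Chain s μ × (Fin s → ℕ),
      ∀ x, sz x.1.1 = sz μ + ∑ j, (e x).2 j ∧
        sz x.1.1 + etot x.2 = sz μ + etot (e x).1 + ∑ j : Fin s, ((j : ℕ) + 1) * (e x).2 j := by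
  induction s with
  | zero =>
    intro μ
    have hμ : ∀ x : (Σ l : {l // Inter l μ}, Chain 0 l.1), μ = 0 := by
      intro x
      have h := chain_zero x.2
      have := x.1.2
      rw [h] at this
      exact inter_zero this
    have : Subsingleton (Σ l : {l // Inter l μ}, Chain 0 l.1) := ⟨by
      rintro ⟨⟨l, h⟩, c⟩ ⟨⟨l', h'⟩, c'⟩
      obtain rfl := chain_zero c
      obtain rfl := chain_zero c'
      rw [Subsingleton.elim c c']⟩
    refine ⟨equivOfSubsingletonOfSubsingleton
      (fun x => (zChain 0 μ (hμ x), fun _ => 0))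
      (fun y => ⟨⟨0, by rw [chain_zero y.1]; intro k; simp⟩, zChain 0 0 rfl⟩), ?_⟩
    intro x
    have h1 := chain_zero x.2
    have h2 := hμ x
    simp [h1, h2, etot]
  | succ s ih =>
    intro μ
    choose e he using ih
    let e0 : (Σ l : {l // Inter l μ}, Chain (s + 1) l.1) ≃
        (Σ l : {l // Inter l μ}, Σ ν : {ν // Inter l.1 ν}, Chain s ν.1) :=
      Equiv.sigmaCongrRight fun l => chainSucc s l.1
    let e1 : (Σ l : {l // Inter l μ}, Σ ν : {ν // Inter l.1 ν}, Chain s ν.1) ≃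
        (Σ ν : ℕ →₀ ℕ, {l // Inter l μ ∧ Inter l ν} × Chain s ν) :=
      { toFun := fun x => ⟨x.2.1.1, ⟨x.1.1, x.1.2, x.2.1.2⟩, x.2.2⟩
        invFun := fun y => ⟨⟨y.2.1.1, y.2.1.2.1⟩, ⟨y.1, y.2.1.2.2⟩, y.2.2⟩
        left_inv := fun _ => rfl
        right_inv := fun _ => rfl }
    let e2 : (Σ ν : ℕ →₀ ℕ, {l // Inter l μ ∧ Inter l ν} × Chain s ν) ≃
        (Σ ν : ℕ →₀ ℕ, ({κ // Inter μ κ ∧ Inter ν κ} × ℕ) × Chain s ν) :=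
      Equiv.sigmaCongrRight fun ν => Equiv.prodCongr (loc μ ν) (Equiv.refl _)
    let e3 : (Σ ν : ℕ →₀ ℕ, ({κ // Inter μ κ ∧ Inter ν κ} × ℕ) × Chain s ν) ≃
        (Σ κ : {κ // Inter μ κ}, (Σ ν : {ν // Inter ν κ.1}, Chain s ν.1) × ℕ) :=
      { toFun := fun x => ⟨⟨x.2.1.1.1, x.2.1.1.2.1⟩, ⟨⟨x.1, x.2.1.1.2.2⟩, x.2.2⟩, x.2.1.2⟩
        invFun := fun y => ⟨y.2.1.1.1, (⟨y.1.1, y.1.2, y.2.1.1.2⟩, y.2.2), y.2.1.2⟩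
        left_inv := fun _ => rfl
        right_inv := fun _ => rfl }
    let e4 : (Σ κ : {κ // Inter μ κ}, (Σ ν : {ν // Inter ν κ.1}, Chain s ν.1) × ℕ) ≃
        (Σ κ : {κ // Inter μ κ}, (Chain s κ.1 × (Fin s → ℕ)) × ℕ) :=
      Equiv.sigmaCongrRight fun κ => Equiv.prodCongr (e κ.1) (Equiv.refl _)
    let e5 : (Σ κ : {κ // Inter μ κ}, (Chain s κ.1 × (Fin s → ℕ)) × ℕ) ≃
        Chain (s + 1) μ × (Fin (s + 1) → ℕ) :=
      Equiv.trans (β := (Σ κ : {κ // Inter μ κ}, Chain s κ.1) × ((Fin s → ℕ) × ℕ))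
      { toFun := fun x => (⟨x.1, x.2.1.1⟩, (x.2.1.2, x.2.2))
        invFun := fun y => ⟨y.1.1, (y.1.2, y.2.1), y.2.2⟩
        left_inv := fun _ => rfl
        right_inv := fun _ => rfl } (Equiv.prodCongr (chainSucc s μ).symm (consE s ℕ))
    refine ⟨e0.trans (e1.trans (e2.trans (e3.trans (e4.trans e5)))), ?_⟩
    rintro ⟨⟨l, hl⟩, c⟩
    obtain ⟨⟨⟨ν, hν⟩, c⟩, rfl⟩ := (chainSucc s l).symm.surjective c
    have h1 := loc_sz μ ν ⟨l, hl, hν⟩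
    have h2 := he (loc μ ν ⟨l, hl, hν⟩).1.1 ⟨⟨ν, (loc μ ν ⟨l, hl, hν⟩).1.2.2⟩, c⟩
    simp only [etot_symm, Equiv.trans_apply, e0, e1, e2, e3, e4, e5, Equiv.coe_fn_mk,
      Equiv.sigmaCongrRight_apply, Equiv.apply_symm_apply, Fin.sum_univ_succ,
      consE_zero, consE_succ, Equiv.prodCongr_apply, Prod.map, Equiv.refl_apply,
      Fin.val_zero, Fin.val_succ] at h1 h2 ⊢
    simp only [add_mul, one_mul, Finset.sum_add_distrib, zero_add] at h2 ⊢
    omega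

theorem full (s r : ℕ) : ∀ t : ℕ,
    ∃ e : (Σ l : ℕ →₀ ℕ, Chain r l × Chain s l) ≃ (Fin r → Fin s → ℕ),
      ∀ x, t * sz x.1 + etot x.2.1 + (sz x.1 + etot x.2.2) =
        ∑ i : Fin r, ∑ j : Fin s, (t + i + j + 1) * e x i j := by
  induction r with
  | zero =>
    intro t
    have : Subsingleton (Σ l : ℕ →₀ ℕ, Chain 0 l × Chain s l) := ⟨by
      rintro ⟨l, c, d⟩ ⟨l', c', d'⟩
      obtain rfl := chain_zero c
      obtain rfl := chain_zero c'
      rw [Subsingleton.elim c c']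
      congr 2
      apply Subtype.ext
      funext j
      rw [chain_all_zero (s := 0) d.2.1 d.2.2.2 j (by omega),
        chain_all_zero (s := 0) d'.2.1 d'.2.2.2 j (by omega)]⟩
    refine ⟨equivOfSubsingletonOfSubsingleton (fun _ _ _ => 0)
      (fun _ => ⟨0, zChain 0 0 rfl, zChain s 0 rfl⟩), ?_⟩
    rintro x
    rw [Subsingleton.elim x ⟨0, zChain 0 0 rfl, zChain s 0 rfl⟩]
    simp [etot, zChain]
  | succ r ih =>
    intro t
    obtain ⟨e, he⟩ := ih (t + 1)
    choose f hf using row s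
    let e0 : (Σ l : ℕ →₀ ℕ, Chain (r + 1) l × Chain s l) ≃
        (Σ l : ℕ →₀ ℕ, (Σ μ : {μ // Inter l μ}, Chain r μ.1) × Chain s l) :=
      Equiv.sigmaCongrRight fun l => Equiv.prodCongr (chainSucc r l) (Equiv.refl _)
    let e1 : (Σ l : ℕ →₀ ℕ, (Σ μ : {μ // Inter l μ}, Chain r μ.1) × Chain s l) ≃
        (Σ μ : ℕ →₀ ℕ, Chain r μ × Σ l : {l // Inter l μ}, Chain s l.1) :=
      { toFun := fun x => ⟨x.2.1.1.1, x.2.1.2, ⟨x.1, x.2.1.1.2⟩, x.2.2⟩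
        invFun := fun y => ⟨y.2.2.1.1, ⟨⟨y.1, y.2.2.1.2⟩, y.2.1⟩, y.2.2.2⟩
        left_inv := fun _ => rfl
        right_inv := fun _ => rfl }
    let e2 : (Σ μ : ℕ →₀ ℕ, Chain r μ × Σ l : {l // Inter l μ}, Chain s l.1) ≃
        (Σ μ : ℕ →₀ ℕ, Chain r μ × (Chain s μ × (Fin s → ℕ))) :=
      Equiv.sigmaCongrRight fun μ => Equiv.prodCongr (Equiv.refl _) (f μ)
    let e3 : (Σ μ : ℕ →₀ ℕ, Chain r μ × (Chain s μ × (Fin s → ℕ))) ≃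
        (Fin (r + 1) → Fin s → ℕ) :=
      Equiv.trans (β := (Σ μ : ℕ →₀ ℕ, Chain r μ × Chain s μ) × (Fin s → ℕ))
      { toFun := fun x => (⟨x.1, x.2.1, x.2.2.1⟩, x.2.2.2)
        invFun := fun y => ⟨y.1.1, y.1.2.1, (y.1.2.2, y.2)⟩
        left_inv := fun _ => rfl
        right_inv := fun _ => rfl }
        ((Equiv.prodCongr e (Equiv.refl _)).trans (consE r (Fin s → ℕ)))
    refine ⟨e0.trans (e1.trans (e2.trans e3)), ?_⟩
    rintro ⟨l, c, d⟩
    obtain ⟨⟨⟨μ, hμ⟩, c⟩, rfl⟩ := (chainSucc r l).symm.surjective c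
    have h1 := hf μ ⟨⟨l, hμ⟩, d⟩
    have h2 := he ⟨μ, c, (f μ ⟨⟨l, hμ⟩, d⟩).1⟩
    simp only [etot_symm, Equiv.trans_apply, e0, e1, e2, e3, Equiv.coe_fn_mk,
      Equiv.sigmaCongrRight_apply, Equiv.apply_symm_apply, Fin.sum_univ_succ,
      consE_zero, consE_succ, Equiv.prodCongr_apply, Prod.map, Equiv.refl_apply,
      Fin.val_zero, Fin.val_succ] at h1 h2 ⊢
    have h3 : ∀ A : Fin s → ℕ, ∑ j : Fin s, (t + 0 + (j : ℕ) + 1) * A j =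
        t * ∑ j, A j + ∑ j : Fin s, ((j : ℕ) + 1) * A j := by
      intro A
      rw [Finset.mul_sum, ← Finset.sum_add_distrib]
      exact Finset.sum_congr rfl fun j _ => by ring
    have h4 : ∀ B : Fin r → Fin s → ℕ, ∑ i : Fin r, ∑ j : Fin s, (t + ((i : ℕ) + 1) + (j : ℕ) + 1) * B i j =
        ∑ i : Fin r, ∑ j : Fin s, (t + 1 + (i : ℕ) + (j : ℕ) + 1) * B i j := by
      intro B
      exact Finset.sum_congr rfl fun i _ => Finset.sum_congr rfl fun j _ => by ring
    rw [h3, h4, ← h2]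
    obtain ⟨h5, h6⟩ := h1
    have h7 : t * sz l = t * sz μ + t * ∑ j, (f μ ⟨⟨l, hμ⟩, d⟩).2 j := by
      rw [h5, mul_add]
    rw [h7, add_mul]
    omega

end PPaux

namespace PPaux

/-- Plane partitions extended by zero to the quadrant. -/
def G (r s : ℕ) : Type :=
  {F : ℕ → ℕ → ℕ // (∀ i j, F (i + 1) j ≤ F i j) ∧ (∀ i j, F i (j + 1) ≤ F i j) ∧
    F r 0 = 0 ∧ F 0 s = 0}

theorem G_anti {F : ℕ → ℕ → ℕ} (h1 : ∀ i j, F (i + 1) j ≤ F i j) (h2 : ∀ i j, F i (j + 1) ≤ F i j)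
    {i j i' j' : ℕ} (hi : i ≤ i') (hj : j ≤ j') : F i' j' ≤ F i j :=
  le_trans (antitone_nat_of_succ_le (f := fun i => F i j') (fun i => h1 i j') hi)
    (antitone_nat_of_succ_le (f := F i) (fun j => h2 i j) hj)

theorem G_zero {r s : ℕ} (F : G r s) {i j : ℕ} (h : r ≤ i ∨ s ≤ j) : F.1 i j = 0 := by
  rcases h with h | h
  · have := G_anti F.2.1 F.2.2.1 h (Nat.zero_le j)
    have := F.2.2.2.1
    omega
  · have := G_anti F.2.1 F.2.2.1 (Nat.zero_le i) h
    have := F.2.2.2.2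
    omega

/-- Extension by zero. -/
def ext0 {r s : ℕ} (f : Fin r × Fin s → ℕ) (i j : ℕ) : ℕ :=
  if h : i < r ∧ j < s then f (⟨i, h.1⟩, ⟨j, h.2⟩) else 0

/-- Plane partitions as functions on the quadrant. -/
def toG (r s : ℕ) : {f : Fin r × Fin s → ℕ //
    ∀ p q : Fin r × Fin s, p.1 ≤ q.1 → p.2 ≤ q.2 → f q ≤ f p} ≃ G r s where
  toFun f := ⟨ext0 f.1, by
    refine ⟨fun i j => ?_, fun i j => ?_, ?_, ?_⟩
    · unfold ext0
      split_ifs with h h' h'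
      · exact f.2 _ _ (by simp) (by simp)
      · omega
      · omega
      · omega
    · unfold ext0
      split_ifs with h h' h'
      · exact f.2 _ _ (by simp) (by simp)
      · omega
      · omega
      · omega
    · simp [ext0]
    · simp [ext0]⟩
  invFun F := ⟨fun p => F.1 p.1 p.2, fun p q h1 h2 => G_anti F.2.1 F.2.2.1 h1 h2⟩
  left_inv f := by
    apply Subtype.ext
    funext p
    simp [ext0]
  right_inv F := by
    apply Subtype.ext
    funext i j
    simp only [ext0]
    split_ifs with h
    · rfl
    · rw [G_zero F (by omega)]

theorem sum_toG (r s : ℕ) (f) :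
    ∑ p, f.1 p = ∑ p ∈ Finset.range r ×ˢ Finset.range s, (toG r s f).1 p.1 p.2 := by
  rw [Finset.sum_product, Fintype.sum_prod_type, Finset.sum_range]
  refine Finset.sum_congr rfl fun i _ => ?_
  rw [Finset.sum_range]
  refine Finset.sum_congr rfl fun j _ => ?_
  change f.1 (i, j) = ext0 f.1 i j
  simp [ext0]

/-- A sequence vanishing from `r` on. -/
noncomputable def mkF (r : ℕ) (f : ℕ → ℕ) (h : ∀ k, r ≤ k → f k = 0) : ℕ →₀ ℕ :=
  Finsupp.onFinset (Finset.range r) f (fun k hk => by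
    rw [Finset.mem_range]
    by_contra hc
    exact hk (h k (by omega)))

/-- The quadrant function built from the diagonals. -/
def glue (E D : ℕ → (ℕ →₀ ℕ)) (i j : ℕ) : ℕ :=
  if i ≤ j then D (j - i) i else E (i - j) j

theorem glue_le (E D : ℕ → (ℕ →₀ ℕ)) (k j : ℕ) : glue E D k (k + j) = D j k := by
  simp [glue]

theorem glue_ge (E D : ℕ → (ℕ →₀ ℕ)) (h : E 0 = D 0) (k j : ℕ) : glue E D (k + j) k = E j k := by
  unfold glue
  split_ifs with hc
  · obtain rfl : j = 0 := by omega
    simp [h]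
  · simp

/-- Diagonals of a plane partition. -/
noncomputable def toS (r s : ℕ) : G r s ≃ Σ l : ℕ →₀ ℕ, Chain r l × Chain s l where
  toFun F := ⟨mkF r (fun k => F.1 k k) (fun k hk => G_zero F (Or.inl hk)),
    ⟨fun i => mkF r (fun k => F.1 (k + i) k) (fun k hk => G_zero F (by omega)), rfl, by
        ext k
        exact G_zero F (by omega), fun j k => ⟨by
          simp only [mkF, Finsupp.onFinset_apply]
          exact F.2.1 _ _, by
          simp only [mkF, Finsupp.onFinset_apply]
          exact G_anti F.2.1 F.2.2.1 (by omega) (by omega)⟩⟩,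
    ⟨fun i => mkF r (fun k => F.1 k (k + i)) (fun k hk => G_zero F (by omega)), rfl, by
        ext k
        exact G_zero F (by omega), fun j k => ⟨by
          simp only [mkF, Finsupp.onFinset_apply]
          exact F.2.2.1 _ _, by
          simp only [mkF, Finsupp.onFinset_apply]
          exact G_anti F.2.1 F.2.2.1 (by omega) (by omega)⟩⟩⟩
  invFun x := ⟨glue x.2.1.1 x.2.2.1, by
    have h0 : x.2.1.1 0 = x.2.2.1 0 := by rw [x.2.1.2.1, x.2.2.2.1]
    refine ⟨fun i j => ?_, fun i j => ?_, ?_, ?_⟩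
    · rcases Nat.lt_or_ge i j with h | h
      · obtain ⟨d, rfl⟩ : ∃ d, j = i + 1 + d := ⟨j - (i + 1), by omega⟩
        rw [glue_le, add_assoc, glue_le, add_comm 1 d]
        exact (x.2.2.2.2.2 d i).2
      · obtain ⟨d, rfl⟩ : ∃ d, i = j + d := ⟨i - j, by omega⟩
        rw [glue_ge _ _ h0, add_assoc, glue_ge _ _ h0]
        exact (x.2.1.2.2.2 d j).1
    · rcases Nat.lt_or_ge j i with h | h
      · obtain ⟨d, rfl⟩ : ∃ d, i = j + 1 + d := ⟨i - (j + 1), by omega⟩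
        rw [glue_ge _ _ h0, add_assoc, glue_ge _ _ h0, add_comm 1 d]
        exact (x.2.1.2.2.2 d j).2
      · obtain ⟨d, rfl⟩ : ∃ d, j = i + d := ⟨j - i, by omega⟩
        rw [glue_le, add_assoc, glue_le]
        exact (x.2.2.2.2.2 d i).1
    · have := glue_ge x.2.1.1 x.2.2.1 h0 0 r
      rw [zero_add] at this
      rw [this, x.2.1.2.2.1]
      rfl
    · have := glue_le x.2.1.1 x.2.2.1 0 s
      rw [zero_add] at this
      rw [this, x.2.2.2.2.1]
      rfl⟩
  left_inv F := by
    apply Subtype.ext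
    funext i j
    simp only [glue, mkF, Finsupp.onFinset_apply]
    split_ifs with h
    · rw [show i + (j - i) = j by omega]
    · rw [show j + (i - j) = i by omega]
  right_inv x := by
    obtain ⟨l, ⟨E, hE0, hE⟩, ⟨D, hD0, hD⟩⟩ := x
    have h0 : E 0 = D 0 := by rw [hE0, hD0]
    subst hD0
    have key : ∀ (l l' : ℕ →₀ ℕ) (hl : l = l') (c : Chain r l) (c' : Chain r l')
        (d : Chain s l) (d' : Chain s l'), c.1 = c'.1 → d.1 = d'.1 →
        (⟨l, c, d⟩ : Σ l : ℕ →₀ ℕ, Chain r l × Chain s l) = ⟨l', c', d'⟩ := by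
      intro l l' hl c c' d d' hc hd
      subst hl
      rw [Subtype.ext hc, Subtype.ext hd]
    apply key
    · ext k
      exact glue_le E D k 0
    · funext i
      ext k
      exact glue_ge E D h0 k i
    · funext i
      ext k
      exact glue_le E D k i

theorem sz_mkF (r : ℕ) (f : ℕ → ℕ) (h) : sz (mkF r f h) = ∑ k ∈ Finset.range r, f k :=
  sz_eq _ r h

theorem sum_toS (r s : ℕ) (F : G r s) :
    0 * sz (toS r s F).1 + etot (toS r s F).2.1 + (sz (toS r s F).1 + etot (toS r s F).2.2) =
      ∑ p ∈ Finset.range r ×ˢ Finset.range s, F.1 p.1 p.2 := by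
  have e1 : etot (toS r s F).2.1 = ∑ p ∈ Finset.range r ×ˢ Finset.range r,
      F.1 (p.2 + (p.1 + 1)) p.2 := by
    rw [Finset.sum_product]
    exact Finset.sum_congr rfl fun i _ =>
      sz_mkF r (fun k => F.1 (k + (i + 1)) k) (fun k hk => G_zero F (by omega))
  have e2 : sz (toS r s F).1 + etot (toS r s F).2.2 =
      ∑ p ∈ Finset.range (s + 1) ×ˢ Finset.range r, F.1 p.2 (p.2 + p.1) := by
    rw [Finset.sum_product, Finset.sum_range_succ', add_comm]
    congr 1
    · exact Finset.sum_congr rfl fun i _ =>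
        sz_mkF r (fun k => F.1 k (k + (i + 1))) (fun k hk => G_zero F (by omega))
    · exact sz_mkF r (fun k => F.1 k k) (fun k hk => G_zero F (by omega))
  rw [e1, e2, zero_mul, zero_add, add_comm,
    ← Finset.sum_filter_add_sum_filter_not (Finset.range r ×ˢ Finset.range s)
      (fun p => p.1 ≤ p.2)]
  congr 1
  · symm
    apply Finset.sum_of_injOn (fun p => (p.2 - p.1, p.1))
    · rintro ⟨a, b⟩ h1 ⟨c, d⟩ h2 h
      simp at h1 h2 h ⊢
      omega
    · rintro ⟨a, b⟩ h1
      simp at h1 ⊢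
      omega
    · rintro ⟨d, k⟩ h1 h2
      apply G_zero
      by_contra hc
      apply h2
      refine ⟨(k, k + d), ?_, ?_⟩
      · simp
        omega
      · simp
    · rintro ⟨a, b⟩ h1
      simp at h1
      simp only
      rw [show a + (b - a) = b by omega]
  · symm
    apply Finset.sum_of_injOn (fun p => (p.1 - p.2 - 1, p.2))
    · rintro ⟨a, b⟩ h1 ⟨c, d⟩ h2 h
      simp at h1 h2 h ⊢
      omega
    · rintro ⟨a, b⟩ h1
      simp at h1 ⊢
      omega
    · rintro ⟨d, k⟩ h1 h2
      apply G_zero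
      by_contra hc
      apply h2
      refine ⟨(k + (d + 1), k), ?_, ?_⟩
      · simp
        omega
      · simp
    · rintro ⟨a, b⟩ h1
      simp at h1
      simp only
      rw [show b + (a - b - 1 + 1) = a by omega]

end PPaux

namespace PPaux
open PowerSeries in
theorem inv_geom (h : ℕ) (hh : 1 ≤ h) : (1 - (X : PowerSeries ℚ) ^ h)⁻¹ =
    PowerSeries.mk fun n => if h ∣ n then 1 else 0 := by
  symm
  rw [PowerSeries.eq_inv_iff_mul_eq_one (by simp [show h ≠ 0 by omega])]
  ext n
  rw [mul_sub, mul_one, map_sub, PowerSeries.coeff_mul_X_pow', coeff_mk, coeff_one]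
  by_cases hn : h ≤ n
  · have : h ∣ n - h ↔ h ∣ n := by
      rw [Nat.dvd_sub_iff_left hn (dvd_refl h)]
    simp only [hn, if_true, coeff_mk, this, sub_self]
    rw [if_neg (by omega)]
  · rw [if_neg hn]
    by_cases h0 : n = 0
    · simp [h0]
    · rw [if_neg, if_neg h0, sub_zero]
      intro hd
      exact hn (Nat.le_of_dvd (by omega) hd)

theorem count {ι : Type} [Fintype ι] [DecidableEq ι] (h : ι → ℕ) (hh : ∀ i, 1 ≤ h i) (n : ℕ) :
    (PowerSeries.coeff n) (∏ i, (1 - (PowerSeries.X : PowerSeries ℚ) ^ (h i))⁻¹) =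
      (Nat.card {A : ι → ℕ // ∑ i, h i * A i = n} : ℚ) := by
  have h1 : ∀ i, (1 - (PowerSeries.X : PowerSeries ℚ) ^ (h i))⁻¹ = _ := fun i => inv_geom (h i) (hh i)
  simp only [h1]
  rw [PowerSeries.coeff_prod]
  simp only [PowerSeries.coeff_mk]
  simp only [Finset.prod_ite_zero, Finset.prod_const_one]
  rw [Finset.sum_boole]
  congr 1
  rw [← Nat.card_eq_finsetCard]
  refine Nat.card_congr
    { toFun := fun x => ⟨fun i => x.1 i / h i, ?_⟩
      invFun := fun A => ⟨Finsupp.equivFunOnFinite.symm fun i => h i * A.1 i, ?_⟩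
      left_inv := ?_
      right_inv := ?_ }
  · have := x.2
    simp only [Finset.mem_filter, Finset.mem_finsuppAntidiag] at this
    refine Eq.trans ?_ this.1.1
    exact Finset.sum_congr rfl fun i _ => Nat.mul_div_cancel' (this.2 i (Finset.mem_univ _))
  · have := A.2
    simp only [Finset.mem_filter, Finset.mem_finsuppAntidiag]
    refine ⟨⟨this, Finset.subset_univ _⟩, fun i _ => Dvd.intro _ rfl⟩
  · intro x
    have := x.2
    simp only [Finset.mem_filter, Finset.mem_finsuppAntidiag] at this
    apply Subtype.ext
    ext i
    exact Nat.mul_div_cancel' (this.2 i (Finset.mem_univ _))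
  · intro A
    apply Subtype.ext
    funext i
    exact Nat.mul_div_cancel_left _ (hh i)

theorem regroup (g : ℕ → PowerSeries ℚ) (m l : ℕ) (hl : 1 ≤ l) (hlm : l ≤ m) :
    ∏ i ∈ Finset.range l, ∏ j ∈ Finset.range m, g (i + j + 1) =
      (∏ j ∈ Finset.Icc l m, g j ^ l) *
      ∏ i ∈ Finset.Icc 1 (l - 1), g i ^ i * g (m + i) ^ (l - i) := by
  induction l, hl using Nat.le_induction with
  | base =>
    simp
    rw [Finset.range_eq_Ico, Finset.prod_Ico_add' (fun j => g j) 0 m 1]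
    rfl
  | succ l hl ih =>
    rw [Finset.prod_range_succ, ih (by omega)]
    have a1 : ∏ j ∈ Finset.range m, g (l + j + 1) =
        (∏ j ∈ Finset.Icc (l + 1) m, g j) * ∏ i ∈ Finset.Icc 1 l, g (m + i) := by
      have b1 : ∏ i ∈ Finset.Icc 1 l, g (m + i) = ∏ j ∈ Finset.Ico (m + 1) (m + l + 1), g j := by
        rw [show m + 1 = 1 + m by ring, show m + l + 1 = (l + 1) + m by ring,
          ← Finset.prod_Ico_add' (fun j => g j) 1 (l + 1) m]
        simp only [add_comm m]
        rfl
      have b2 : ∏ j ∈ Finset.range m, g (l + j + 1) =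
          ∏ j ∈ Finset.Ico (l + 1) (m + l + 1), g j := by
        have := Finset.prod_Ico_add' (fun j => g j) 0 m (l + 1)
        rw [show 0 + (l + 1) = l + 1 by ring] at this
        rw [show m + l + 1 = m + (l + 1) by ring, ← this, Finset.range_eq_Ico]
        exact Finset.prod_congr rfl fun j _ => by congr 1; ring
      rw [b1, b2, ← Finset.prod_Ico_consecutive (fun j => g j) (by omega : l + 1 ≤ m + 1)
        (by omega : m + 1 ≤ m + l + 1)]
      rfl
    have a2 : ∏ j ∈ Finset.Icc l m, g j ^ l = g l ^ l * ∏ j ∈ Finset.Icc (l + 1) m, g j ^ l := by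
      rw [← Finset.insert_Icc_add_one_left_eq_Icc (by omega : l ≤ m), Finset.prod_insert (by simp)]
    have a3 : ∏ i ∈ Finset.Icc 1 l, g i ^ i * g (m + i) ^ (l + 1 - i) =
      g l ^ l * (∏ i ∈ Finset.Icc 1 (l - 1), g i ^ i * g (m + i) ^ (l - i)) *
         ∏ i ∈ Finset.Icc 1 l, g (m + i) := by
      have c1 : ∏ i ∈ Finset.Icc 1 l, g i ^ i * g (m + i) ^ (l + 1 - i) = 
        (∏ i ∈ Finset.Icc 1 l, g i ^ i * g (m + i) ^ (l - i)) * ∏ i ∈ Finset.Icc 1 l, g (m + i) := by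
        rw [← Finset.prod_mul_distrib]
        refine Finset.prod_congr rfl fun i hi => ?_
        rw [Finset.mem_Icc] at hi
        rw [show l + 1 - i = l - i + 1 by omega, pow_succ]
        ring
      rw [c1]
      congr 1
      obtain ⟨k, rfl⟩ : ∃ k, l = k + 1 := ⟨l - 1, by omega⟩
      rw [Finset.prod_Icc_succ_top (by omega)]
      simp
      ring
    rw [a1, a2, Nat.add_sub_cancel, a3]
    simp only [pow_succ, Finset.prod_mul_distrib]
    ring
end PPaux

theorem PPaux.PP_eq (n r s : ℕ) : PP n r s = Nat.card {A : Fin r × Fin s → ℕ //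
    ∑ p : Fin r × Fin s, ((p.1 : ℕ) + p.2 + 1) * A p = n} := by
  obtain ⟨e, he⟩ := PPaux.full s r 0
  let E := ((PPaux.toG r s).trans (PPaux.toS r s)).trans (e.trans (Equiv.curry _ _ _).symm)
  have hE : ∀ f, ∑ p : Fin r × Fin s, ((p.1 : ℕ) + p.2 + 1) * E f p = ∑ p, f.1 p := by
    intro f
    rw [PPaux.sum_toG, ← PPaux.sum_toS, he, Fintype.sum_prod_type]
    simp [E]
  unfold PP
  refine Nat.card_congr (Equiv.trans (β := {f : {f : Fin r × Fin s → ℕ //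
    ∀ p q : Fin r × Fin s, p.1 ≤ q.1 → p.2 ≤ q.2 → f q ≤ f p} // ∑ p, f.1 p = n})
    { toFun := fun f => ⟨⟨f.1, f.2.2⟩, f.2.1⟩
      invFun := fun f => ⟨f.1.1, f.2, f.1.2⟩
      left_inv := fun _ => rfl
      right_inv := fun _ => rfl } (E.subtypeEquiv fun f => by rw [hE f]))

theorem planePartition_rectangle_genFun (r s : ℕ) (hr : 1 ≤ r) (hs : 1 ≤ s) :
    PowerSeries.mk (fun n => (PP n r s : ℚ)) =
      (∏ j ∈ Finset.Icc (min r s) (max r s),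
          ((1 - (PowerSeries.X : PowerSeries ℚ) ^ j)⁻¹) ^ (min r s)) *
      ∏ i ∈ Finset.Icc 1 (min r s - 1),
        ((1 - (PowerSeries.X : PowerSeries ℚ) ^ i)⁻¹) ^ i *
          ((1 - (PowerSeries.X : PowerSeries ℚ) ^ (max r s + i))⁻¹) ^ (min r s - i) := by
  have key : PowerSeries.mk (fun n => (PP n r s : ℚ)) =
      ∏ i ∈ Finset.range r, ∏ j ∈ Finset.range s,
        (1 - (PowerSeries.X : PowerSeries ℚ) ^ (i + j + 1))⁻¹ := by
    ext n
    rw [PowerSeries.coeff_mk, PPaux.PP_eq,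
      ← PPaux.count (fun p : Fin r × Fin s => (p.1 : ℕ) + p.2 + 1) (fun p => by omega) n]
    rw [Fintype.prod_prod_type, Finset.prod_range]
    congr 1
    refine Finset.prod_congr rfl fun i _ => ?_
    rw [Finset.prod_range]
  rw [key]
  rcases le_total r s with h | h
  · rw [min_eq_left h, max_eq_right h]
    exact PPaux.regroup (fun j => (1 - (PowerSeries.X : PowerSeries ℚ) ^ j)⁻¹) s r hr h
  · rw [min_eq_right h, max_eq_left h, Finset.prod_comm]
    rw [← PPaux.regroup (fun j => (1 - (PowerSeries.X : PowerSeries ℚ) ^ j)⁻¹) r s hs h]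
    refine Finset.prod_congr rfl fun i _ => Finset.prod_congr rfl fun j _ => ?_
    rw [add_comm j i]
end

section
/- (MacMahon's box formula) Let r, s, t be nonnegative integers. Then, as an identity of formal power series over ℚ, Σ_{n≥0} PP_t(n; r, s)·x^n · Π_{i=1}^{r} Π_{j=1}^{s} (1 − x^{i+j−1}) = Π_{i=1}^{r} Π_{j=1}^{s} (1 − x^{i+j+t−1}). -/
/-- `PPbox n r s t` : number of plane partitions of `n` fitting inside the box
`B(r, s, t)`, i.e. functions `f : Fin r × Fin s → ℕ` with total sum `n`, weakly
decreasing in each coordinate, with all values at most `t`. -/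
noncomputable def PPbox (n r s t : ℕ) : ℕ :=
  Nat.card {f : Fin r × Fin s → ℕ //
    (∑ p, f p) = n ∧
    (∀ p q : Fin r × Fin s, p.1 ≤ q.1 → p.2 ≤ q.2 → f q ≤ f p) ∧
    ∀ p, f p ≤ t}
open PowerSeries in
noncomputable def bV (n : ℕ) (l : Fin n → ℕ) : PowerSeries ℚ :=
  Matrix.det (Matrix.of fun i j : Fin n => (X : PowerSeries ℚ) ^ (l i * (j : ℕ)))

noncomputable def bD : ℕ → PowerSeries ℚ
  | 0 => 1
  | n + 1 => bD n * ∏ j : Fin n, ((PowerSeries.X : PowerSeries ℚ) ^ ((j : ℕ) + 1) - 1)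

theorem bV_succ_rows (n : ℕ) (l : Fin (n + 1) → ℕ) :
    bV (n + 1) l = Matrix.det (Matrix.of fun i j : Fin n =>
      (PowerSeries.X : PowerSeries ℚ) ^ (l i.succ * ((j : ℕ) + 1))
        - PowerSeries.X ^ (l i.castSucc * ((j : ℕ) + 1))) := by
  unfold bV
  rw [Matrix.det_eq_of_forall_row_eq_smul_add_pred (B := Matrix.of (fun i j : Fin (n + 1) =>
    Fin.cases ((PowerSeries.X : PowerSeries ℚ) ^ (l 0 * (j : ℕ)))
      (fun i' : Fin n => (PowerSeries.X : PowerSeries ℚ) ^ (l i'.succ * (j : ℕ))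
        - PowerSeries.X ^ (l i'.castSucc * (j : ℕ))) i)) (fun _ => 1)]
  · rw [Matrix.det_succ_column_zero, Fin.sum_univ_succ, Finset.sum_eq_zero]
    · simp
      congr 1
    · intro i _
      simp
  · intro j
    simp
  · intro i j
    simp

theorem bV_sum (n : ℕ) (l : Fin (n + 1) → ℕ) (hl : StrictMono l) :
    (∑ m ∈ Fintype.piFinset (fun i : Fin n => Finset.Ico (l i.castSucc) (l i.succ)),
      (PowerSeries.X : PowerSeries ℚ) ^ (∑ i, m i) * bV n m) *
      ∏ j : Fin n, ((PowerSeries.X : PowerSeries ℚ) ^ ((j : ℕ) + 1) - 1) = bV (n + 1) l := by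
  have h1 : ∀ m : Fin n → ℕ, (PowerSeries.X : PowerSeries ℚ) ^ (∑ i, m i) * bV n m
      = Matrix.detRowAlternating.toMultilinearMap
        (fun i (j : Fin n) => (PowerSeries.X : PowerSeries ℚ) ^ (m i * ((j : ℕ) + 1))) := by
    intro m
    have := Matrix.det_mul_column (fun i => (PowerSeries.X : PowerSeries ℚ) ^ (m i))
      (Matrix.of fun i j : Fin n => (PowerSeries.X : PowerSeries ℚ) ^ (m i * (j : ℕ)))
    rw [Finset.prod_pow_eq_pow_sum] at this
    rw [bV, ← this]
    change _ = Matrix.det _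
    congr 1
    ext1 i j
    simp only [Matrix.of_apply]
    ring
  rw [Finset.sum_congr rfl (fun m _ => h1 m)]
  rw [← MultilinearMap.map_sum_finset Matrix.detRowAlternating.toMultilinearMap
    (fun (i : Fin n) (a : ℕ) => fun (j : Fin n) => (PowerSeries.X : PowerSeries ℚ) ^ (a * ((j : ℕ) + 1)))
    (fun i : Fin n => Finset.Ico (l i.castSucc) (l i.succ))]
  rw [mul_comm, bV_succ_rows]
  refine (Matrix.det_mul_row (fun j : Fin n => (PowerSeries.X : PowerSeries ℚ) ^ ((j : ℕ) + 1) - 1)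
    (Matrix.of (fun i : Fin n => ∑ a ∈ Finset.Ico (l i.castSucc) (l i.succ),
      fun j : Fin n => (PowerSeries.X : PowerSeries ℚ) ^ (a * ((j : ℕ) + 1))))).symm.trans ?_
  congr 1
  ext1 i j
  simp only [Matrix.of_apply, Finset.sum_apply]
  have hle : l i.castSucc ≤ l i.succ := hl.monotone (Fin.castSucc_lt_succ).le
  rw [mul_comm]
  have := geom_sum_Ico_mul ((PowerSeries.X : PowerSeries ℚ) ^ ((j : ℕ) + 1)) hle
  simp only [← pow_mul] at this
  simpa [mul_comm] using this

def bS (n : ℕ) (l : Fin n → ℕ) (U : ℕ → ℕ → ℕ) : Prop :=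
  (∀ a b, n ≤ a + b → U a b = 0) ∧
  (∀ (a : Fin n) (b : ℕ), (a : ℕ) + b + 1 = n → U a b = l a) ∧
  (∀ a b, a + b + 1 < n → U a (b + 1) ≤ U a b ∧ U a b < U (a + 1) b)

def bwt (n : ℕ) (U : ℕ → ℕ → ℕ) : ℕ :=
  ∑ a ∈ Finset.range n, ∑ b ∈ Finset.range (n - 1 - a), U a b

theorem bwt_succ (n : ℕ) (U : ℕ → ℕ → ℕ) :
    bwt (n + 1) U = bwt n U + ∑ a : Fin n, U a (n - 1 - a) := by
  unfold bwt
  rw [Finset.sum_range_succ]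
  simp only [Nat.add_sub_cancel, Nat.sub_self, Finset.range_zero, Finset.sum_empty, add_zero]
  rw [Finset.sum_fin_eq_sum_range, ← Finset.sum_add_distrib]
  apply Finset.sum_congr rfl
  intro a ha
  have ha := Finset.mem_range.1 ha
  rw [dif_pos ha, show n - a = (n - 1 - a) + 1 by omega, Finset.sum_range_succ]

theorem bmain (n : ℕ) : ∀ (l : Fin n → ℕ), StrictMono l →
    ∃ P : Finset (ℕ → ℕ → ℕ), (∀ U, U ∈ P ↔ bS n l U) ∧
      (∑ U ∈ P, (PowerSeries.X : PowerSeries ℚ) ^ (bwt n U)) * bD n = bV n l := by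
  classical
  induction n with
  | zero =>
    intro l _
    refine ⟨{fun _ _ => 0}, ?_, ?_⟩
    · intro U
      simp only [Finset.mem_singleton, bS]
      constructor
      · rintro rfl
        simp
      · rintro ⟨h, -⟩
        funext a b
        exact h a b (Nat.zero_le _)
    · simp [bwt, bD, bV]
  | succ n ih =>
    intro l hl
    set Q := Fintype.piFinset (fun i : Fin n => Finset.Ico (l i.castSucc) (l i.succ)) with hQ
    have hQm : ∀ m, m ∈ Q ↔ ∀ i : Fin n, l i.castSucc ≤ m i ∧ m i < l i.succ := by
      intro m
      simp [hQ, Fintype.mem_piFinset]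
    have hmono : ∀ m ∈ Q, StrictMono m := by
      intro m hm
      rw [hQm] at hm
      intro i j hij
      calc m i < l i.succ := (hm i).2
        _ ≤ l j.castSucc := hl.monotone (by
          rw [Fin.le_def]; simp; exact hij)
        _ ≤ m j := (hm j).1
    have hex : ∀ m : Fin n → ℕ, ∃ P : Finset (ℕ → ℕ → ℕ), m ∈ Q → ((∀ U, U ∈ P ↔ bS n m U) ∧
      (∑ U ∈ P, (PowerSeries.X : PowerSeries ℚ) ^ (bwt n U)) * bD n = bV n m) := by
      intro m
      by_cases hm : m ∈ Q
      · obtain ⟨P, hP⟩ := ih m (hmono m hm)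
        exact ⟨P, fun _ => hP⟩
      · exact ⟨∅, fun h => absurd h hm⟩
    choose P hP using hex
    -- glueing map
    let glue : (ℕ → ℕ → ℕ) → (ℕ → ℕ → ℕ) := fun U a b =>
      if h : a + b = n then l ⟨a, by omega⟩ else U a b
    let cut : (ℕ → ℕ → ℕ) → (ℕ → ℕ → ℕ) := fun U a b => if a + b = n then 0 else U a b
    let top : (ℕ → ℕ → ℕ) → (Fin n → ℕ) := fun U a => U a (n - 1 - a)
    have hglue : ∀ m ∈ Q, ∀ U, bS n m U → bS (n + 1) l (glue U) ∧ top (glue U) = m ∧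
        cut (glue U) = U := by
      rintro m hm U ⟨h1, h2, h3⟩
      rw [hQm] at hm
      refine ⟨⟨?_, ?_, ?_⟩, ?_, ?_⟩
      · intro a b hab
        simp only [glue]
        rw [dif_neg (by omega)]
        exact h1 a b (by omega)
      · intro a b hab
        simp only [glue]
        rw [dif_pos (by omega)]
      · intro a b hab
        simp only [glue]
        by_cases hc : a + b + 1 = n
        · rw [dif_pos (by omega), dif_neg (by omega), dif_pos (by omega)]
          have := h2 ⟨a, by omega⟩ b hc
          have h' := hm ⟨a, by omega⟩
          simp only at this
          rw [this]
          exact h'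
        · rw [dif_neg (by omega), dif_neg (by omega), dif_neg (by omega)]
          exact h3 a b (by omega)
      · funext a
        simp only [top, glue]
        rw [dif_neg (by omega)]
        exact h2 a _ (by omega)
      · funext a b
        simp only [cut, glue]
        split_ifs with h
        · exact (h1 a b h.ge).symm
        · rfl
    have hcut : ∀ U, bS (n + 1) l U → top U ∈ Q ∧ bS n (top U) (cut U) ∧ glue (cut U) = U := by
      rintro U ⟨h1, h2, h3⟩
      refine ⟨?_, ⟨?_, ?_, ?_⟩, ?_⟩
      · rw [hQm]
        intro i
        have e1 := h2 i.castSucc (n - i) (by simp)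
        have e2 := h2 i.succ (n - 1 - i) (by simp; omega)
        have e3 := h3 i (n - 1 - i) (by omega)
        rw [show n - 1 - (i : ℕ) + 1 = n - i by omega] at e3
        simp only [Fin.val_castSucc, Fin.val_succ] at e1 e2
        rw [← e1, ← e2]
        exact e3
      · intro a b hab
        simp only [cut]
        split_ifs with h
        · rfl
        · exact h1 a b (by omega)
      · intro a b hab
        simp only [cut, top]
        rw [if_neg (by omega), show n - 1 - (a : ℕ) = b by omega]
      · intro a b hab
        simp only [cut]
        rw [if_neg (by omega), if_neg (by omega), if_neg (by omega)]
        exact h3 a b (by omega)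
      · funext a b
        simp only [cut, glue]
        split_ifs with h
        · exact (h2 ⟨a, by omega⟩ b (by simp only [h])).symm
        · rfl
    have hwt : ∀ U, bwt n (cut U) = bwt n U := by
      intro U
      unfold bwt
      refine Finset.sum_congr rfl fun a ha => Finset.sum_congr rfl fun b hb => ?_
      rw [Finset.mem_range] at ha hb
      simp only [cut]
      rw [if_neg (by omega)]
    refine ⟨(Q.sigma P).image (fun x => glue x.2), ?_, ?_⟩
    · intro U
      simp only [Finset.mem_image, Finset.mem_sigma]
      constructor
      · rintro ⟨⟨m, U'⟩, ⟨hm, hU⟩, rfl⟩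
        exact (hglue m hm U' (((hP m hm).1 U').1 hU)).1
      · intro hU
        obtain ⟨c1, c2, c3⟩ := hcut U hU
        exact ⟨⟨top U, cut U⟩, ⟨c1, ((hP _ c1).1 _).2 c2⟩, c3⟩
    · rw [Finset.sum_image, Finset.sum_sigma, bD, ← mul_assoc, Finset.sum_mul, ← bV_sum n l hl]
      · congr 1
        refine Finset.sum_congr rfl fun m hm => ?_
        rw [← (hP m hm).2, ← mul_assoc, Finset.mul_sum]
        congr 1
        refine Finset.sum_congr rfl fun U hU => ?_
        obtain ⟨g1, g2, g3⟩ := hglue m hm U (((hP m hm).1 U).1 hU)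
        rw [bwt_succ, ← hwt (glue U), g3, ← pow_add, add_comm]
        congr 2
        refine Finset.sum_congr rfl fun i _ => ?_
        exact congrFun g2 i
      · rintro ⟨m, U⟩ hx ⟨m', U'⟩ hx' heq
        simp only [Finset.coe_sigma, Set.mem_sigma_iff, Finset.mem_coe] at hx hx'
        obtain ⟨g1, g2, g3⟩ := hglue m hx.1 U (((hP m hx.1).1 U).1 hx.2)
        obtain ⟨g1', g2', g3'⟩ := hglue m' hx'.1 U' (((hP m' hx'.1).1 U').1 hx'.2)
        simp only at heq
        have e1 : m = m' := by rw [← g2, ← g2', heq]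
        have e2 : U = U' := by rw [← g3, ← g3', heq]
        subst e1 e2
        rfl

theorem bD_ne (n : ℕ) : bD n ≠ 0 := by
  induction n with
  | zero => simp [bD]
  | succ n ih =>
    rw [bD]
    refine mul_ne_zero ih (Finset.prod_ne_zero_iff.2 fun j _ h => ?_)
    have := congrArg (PowerSeries.constantCoeff) h
    simp at this

theorem bV_prod (n : ℕ) (L : ℕ → ℕ) :
    bV n (fun i => L i) = ∏ i ∈ Finset.range n, ∏ j ∈ Finset.range (n - 1 - i),
      ((PowerSeries.X : PowerSeries ℚ) ^ L (i + 1 + j) - PowerSeries.X ^ L i) := by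
  have h : bV n (fun i => L i) =
      Matrix.det (Matrix.vandermonde fun i : Fin n => (PowerSeries.X : PowerSeries ℚ) ^ L i) := by
    unfold bV
    congr 1
    ext1 i j
    simp [Matrix.vandermonde_apply, pow_mul]
  rw [h, Matrix.det_vandermonde, ← Fin.prod_univ_eq_prod_range (fun i =>
    ∏ j ∈ Finset.range (n - 1 - i),
      ((PowerSeries.X : PowerSeries ℚ) ^ L (i + 1 + j) - PowerSeries.X ^ L i)) n]
  refine Finset.prod_congr rfl fun i _ => ?_
  refine Finset.prod_bij (fun j _ => (j : ℕ) - i - 1) ?_ ?_ ?_ ?_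
  · intro j hj
    have := Fin.lt_def.1 (Finset.mem_Ioi.1 hj)
    simp only [Finset.mem_range]
    omega
  · intro j hj j' hj' h
    have := Fin.lt_def.1 (Finset.mem_Ioi.1 hj)
    have := Fin.lt_def.1 (Finset.mem_Ioi.1 hj')
    apply Fin.ext
    omega
  · intro k hk
    have := Finset.mem_range.1 hk
    refine ⟨⟨i + 1 + k, by omega⟩, ?_, ?_⟩
    · rw [Finset.mem_Ioi, Fin.lt_def]
      simp only
      omega
    · simp only
      omega
  · intro j hj
    have := Fin.lt_def.1 (Finset.mem_Ioi.1 hj)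
    rw [show (i : ℕ) + 1 + ((j : ℕ) - i - 1) = j by omega]

def bL (s t a : ℕ) : ℕ := if a < s then a else a + t

theorem bL_mono (s t n : ℕ) : StrictMono (fun i : Fin n => bL s t i) := by
  intro i j hij
  have := Fin.lt_def.1 hij
  simp only [bL]
  split_ifs <;> omega

noncomputable def bN (r s t : ℕ) : PowerSeries ℚ :=
  ∏ i ∈ Finset.Icc 1 r, ∏ j ∈ Finset.Icc 1 s,
      (1 - (PowerSeries.X : PowerSeries ℚ) ^ (i + j + t - 1))

theorem bIcc (r : ℕ) (g : ℕ → PowerSeries ℚ) :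
    ∏ i ∈ Finset.Icc 1 r, g i = ∏ i ∈ Finset.range r, g (i + 1) := by
  rw [Finset.range_eq_Ico, Finset.prod_Ico_add' g 0 r 1]
  rfl

theorem bN_eq (r s t : ℕ) : bN r s t = ∏ a ∈ Finset.range s, ∏ j ∈ Finset.range r,
    (1 - (PowerSeries.X : PowerSeries ℚ) ^ (s + j + t - a)) := by
  unfold bN
  rw [Finset.prod_comm, bIcc, ← Finset.prod_range_reflect]
  refine Finset.prod_congr rfl fun a ha => ?_
  rw [bIcc]
  refine Finset.prod_congr rfl fun j hj => ?_
  have := Finset.mem_range.1 ha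
  congr 2
  omega

theorem bV_eval (r s : ℕ) : ∃ C : PowerSeries ℚ, ∀ t,
    bV (s + r) (fun i => bL s t i) =
      C * PowerSeries.X ^ (t * ∑ a ∈ Finset.range r, (r - 1 - a)) * bN r s t := by
  refine ⟨(∏ a ∈ Finset.range s, ∏ j ∈ Finset.range (s - 1 - a),
      ((PowerSeries.X : PowerSeries ℚ) ^ (a + 1 + j) - PowerSeries.X ^ a)) *
    (∏ a ∈ Finset.range s, ∏ j ∈ Finset.range r, (- (PowerSeries.X : PowerSeries ℚ) ^ a)) *
    (∏ a ∈ Finset.range r, ∏ j ∈ Finset.range (r - 1 - a),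
      ((PowerSeries.X : PowerSeries ℚ) ^ (s + a + 1 + j) - PowerSeries.X ^ (s + a))), fun t => ?_⟩
  rw [bV_prod, Finset.prod_range_add, bN_eq]
  have h1 : ∀ a ∈ Finset.range s, ∏ j ∈ Finset.range (s + r - 1 - a),
      ((PowerSeries.X : PowerSeries ℚ) ^ bL s t (a + 1 + j) - PowerSeries.X ^ bL s t a) =
      (∏ j ∈ Finset.range (s - 1 - a),
        ((PowerSeries.X : PowerSeries ℚ) ^ (a + 1 + j) - PowerSeries.X ^ a)) *
      ((∏ j ∈ Finset.range r, (- (PowerSeries.X : PowerSeries ℚ) ^ a)) *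
        ∏ j ∈ Finset.range r, (1 - (PowerSeries.X : PowerSeries ℚ) ^ (s + j + t - a))) := by
    intro a ha
    have ha := Finset.mem_range.1 ha
    rw [show s + r - 1 - a = (s - 1 - a) + r by omega, Finset.prod_range_add,
      ← Finset.prod_mul_distrib]
    congr 1
    · refine Finset.prod_congr rfl fun j hj => ?_
      have hj := Finset.mem_range.1 hj
      simp only [bL]
      rw [if_pos (by omega), if_pos (by omega)]
    · refine Finset.prod_congr rfl fun j hj => ?_
      simp only [bL]
      rw [if_neg (by omega), if_pos (by omega),
        show a + 1 + (s - 1 - a + j) + t = a + (s + j + t - a) by omega, pow_add]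
      ring
  have h2 : ∀ a ∈ Finset.range r, ∏ j ∈ Finset.range (s + r - 1 - (s + a)),
      ((PowerSeries.X : PowerSeries ℚ) ^ bL s t (s + a + 1 + j) - PowerSeries.X ^ bL s t (s + a)) =
      PowerSeries.X ^ (t * (r - 1 - a)) * (∏ j ∈ Finset.range (r - 1 - a),
      ((PowerSeries.X : PowerSeries ℚ) ^ (s + a + 1 + j) - PowerSeries.X ^ (s + a))) := by
    intro a ha
    rw [show s + r - 1 - (s + a) = r - 1 - a by omega, pow_mul]
    nth_rewrite 2 [← Finset.card_range (r - 1 - a)]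
    rw [← Finset.prod_const, ← Finset.prod_mul_distrib]
    refine Finset.prod_congr rfl fun j hj => ?_
    simp only [bL]
    rw [if_neg (by omega), if_neg (by omega)]
    ring
  rw [Finset.prod_congr rfl h1, Finset.prod_congr rfl h2]
  simp only [Finset.prod_mul_distrib]
  rw [Finset.prod_pow_eq_pow_sum, Finset.mul_sum]
  ring

theorem bS_anti {n : ℕ} {l : Fin n → ℕ} {U : ℕ → ℕ → ℕ} (h : bS n l U) (a b k : ℕ)
    (hk : a + b + k < n) : U a (b + k) ≤ U a b := by
  induction k with
  | zero => exact le_rfl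
  | succ k ih => exact ((h.2.2 a (b + k) (by omega)).1).trans (ih (by omega))

theorem bS_incr {n : ℕ} {l : Fin n → ℕ} {U : ℕ → ℕ → ℕ} (h : bS n l U) (a b k : ℕ)
    (hk : a + b + k < n) : U a b + k ≤ U (a + k) b := by
  induction k with
  | zero => exact le_rfl
  | succ k ih =>
    have := (h.2.2 (a + k) b (by omega)).2
    have := ih (by omega)
    rw [← add_assoc a k 1]
    omega

theorem bS_bounds {r s t : ℕ} {U : ℕ → ℕ → ℕ} (h : bS (s + r) (fun i => bL s t i) U) (a b : ℕ)
    (hab : a + b < s + r) : a ≤ U a b ∧ U a b ≤ a + t ∧ (s ≤ a → U a b = a + t) ∧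
      (r ≤ b → U a b = a) := by
  have h1 := bS_anti h a b (s + r - 1 - a - b) (by omega)
  have h2 := bS_incr h a b (s + r - 1 - a - b) (by omega)
  have e1 := h.2.1 ⟨a, by omega⟩ (b + (s + r - 1 - a - b)) (by simp only; omega)
  have e2 := h.2.1 ⟨a + (s + r - 1 - a - b), by omega⟩ b (by simp only; omega)
  simp only [bL] at e1 e2
  split_ifs at e1 e2 <;> refine ⟨?_, ?_, fun _ => ?_, fun _ => ?_⟩ <;> omega

def bf (r s : ℕ) (U : ℕ → ℕ → ℕ) : Fin r × Fin s → ℕ :=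
  fun p => U (s - 1 - p.2) p.1 - (s - 1 - p.2)

def bU (r s t : ℕ) (f : Fin r × Fin s → ℕ) : ℕ → ℕ → ℕ := fun a b =>
  if s + r ≤ a + b then 0 else
  if ha : s ≤ a then a + t else
  if hb : r ≤ b then a else a + f (⟨b, by omega⟩, ⟨s - 1 - a, by omega⟩)

def bc (r s : ℕ) : ℕ := (∑ a ∈ Finset.range s, (r * a + (s - 1 - a) * a)) +
  ∑ a ∈ Finset.range r, (r - 1 - a) * (s + a)

theorem bwt_eq {r s t : ℕ} {U : ℕ → ℕ → ℕ} (h : bS (s + r) (fun i => bL s t i) U) :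
    bwt (s + r) U = bc r s + t * (∑ a ∈ Finset.range r, (r - 1 - a)) + ∑ p, bf r s U p := by
  have hf : ∑ p, bf r s U p = ∑ a ∈ Finset.range s, ∑ b ∈ Finset.range r, (U a b - a) := by
    rw [Fintype.sum_prod_type, Finset.sum_comm, ← Finset.sum_range_reflect,
      ← Fin.sum_univ_eq_sum_range (fun a => ∑ b ∈ Finset.range r, (U (s - 1 - a) b - (s - 1 - a)))]
    refine Finset.sum_congr rfl fun a _ => ?_
    rw [← Fin.sum_univ_eq_sum_range (fun b => (U (s - 1 - a) b - (s - 1 - a)))]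
    rfl
  unfold bwt
  rw [Finset.sum_range_add, hf]
  have h1 : ∀ a ∈ Finset.range s, ∑ b ∈ Finset.range (s + r - 1 - a), U a b =
      (r * a + (s - 1 - a) * a) + ∑ b ∈ Finset.range r, (U a b - a) := by
    intro a ha
    have ha := Finset.mem_range.1 ha
    rw [show s + r - 1 - a = r + (s - 1 - a) by omega, Finset.sum_range_add]
    have e1 : ∑ b ∈ Finset.range r, U a b = r * a + ∑ b ∈ Finset.range r, (U a b - a) := by
      have : r * a = ∑ b ∈ Finset.range r, a := by simp
      rw [this, ← Finset.sum_add_distrib]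
      refine Finset.sum_congr rfl fun b hb => ?_
      have hb := Finset.mem_range.1 hb
      have := (bS_bounds h a b (by omega)).1
      omega
    have e2 : ∑ k ∈ Finset.range (s - 1 - a), U a (r + k) = (s - 1 - a) * a := by
      rw [Finset.sum_congr rfl (g := fun _ => a)]
      · simp
      · intro k hk
        have hk := Finset.mem_range.1 hk
        exact (bS_bounds h a (r + k) (by omega)).2.2.2 (by omega)
    rw [e1, e2]
    ring
  have h2 : ∀ a ∈ Finset.range r, ∑ b ∈ Finset.range (s + r - 1 - (s + a)), U (s + a) b =
      (r - 1 - a) * (s + a) + t * (r - 1 - a) := by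
    intro a ha
    rw [show s + r - 1 - (s + a) = r - 1 - a by omega, Finset.sum_congr rfl (g := fun _ => s + a + t)]
    · simp
      ring
    · intro k hk
      have hk := Finset.mem_range.1 hk
      exact (bS_bounds h (s + a) k (by omega)).2.2.1 (by omega)
  rw [Finset.sum_congr rfl h1, Finset.sum_congr rfl h2, Finset.sum_add_distrib,
    Finset.sum_add_distrib (f := fun a => (r - 1 - a) * (s + a)), ← Finset.mul_sum, bc]
  ring

def bPP (r s t : ℕ) (f : Fin r × Fin s → ℕ) : Prop :=
  (∀ p q : Fin r × Fin s, p.1 ≤ q.1 → p.2 ≤ q.2 → f q ≤ f p) ∧ ∀ p, f p ≤ t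

theorem bf_PP {r s t : ℕ} {U : ℕ → ℕ → ℕ} (h : bS (s + r) (fun i => bL s t i) U) :
    bPP r s t (bf r s U) := by
  constructor
  · rintro ⟨i, j⟩ ⟨i', j'⟩ hi hj
    simp only [Fin.le_def] at hi hj
    simp only [bf]
    have h1 := bS_anti h (s - 1 - j') i (i' - i) (by omega)
    have h2 := bS_incr h (s - 1 - j') i (j' - j) (by omega)
    rw [show (i : ℕ) + (i' - i) = i' by omega] at h1
    rw [show s - 1 - (j' : ℕ) + (j' - j) = s - 1 - j by omega] at h2
    omega
  · rintro ⟨i, j⟩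
    simp only [bf]
    have := (bS_bounds h (s - 1 - j) i (by omega)).2.1
    omega

theorem bU_S {r s t : ℕ} {f : Fin r × Fin s → ℕ} (h : bPP r s t f) :
    bS (s + r) (fun i => bL s t i) (bU r s t f) := by
  refine ⟨?_, ?_, ?_⟩
  · intro a b hab
    simp [bU, hab]
  · intro a b hab
    simp only [bU, bL]
    split_ifs <;> omega
  · intro a b hab
    constructor
    · simp only [bU]
      rw [if_neg (by omega), if_neg (by omega)]
      split_ifs with h1 h2 h3 h4
      · exact le_rfl
      · exact le_rfl
      · omega
      · omega
      · have := h.1 (⟨b, by omega⟩, ⟨s - 1 - a, by omega⟩) (⟨b + 1, by omega⟩, ⟨s - 1 - a, by omega⟩)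
          (by simp [Fin.le_def]) le_rfl
        omega
    · simp only [bU]
      rw [if_neg (by omega), if_neg (by omega)]
      split_ifs
      all_goals try omega
      · have := h.2 (⟨b, by omega⟩, ⟨s - 1 - a, by omega⟩)
        omega
      · have := h.1 (⟨b, by omega⟩, ⟨s - 1 - (a + 1), by omega⟩) (⟨b, by omega⟩, ⟨s - 1 - a, by omega⟩)
          le_rfl (by simp only [Fin.le_def]; omega)
        omega

theorem bU_bf {r s t : ℕ} {U : ℕ → ℕ → ℕ} (h : bS (s + r) (fun i => bL s t i) U) :
    bU r s t (bf r s U) = U := by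
  funext a b
  simp only [bU, bf]
  split_ifs with h1 h2 h3
  · exact (h.1 a b h1).symm
  · exact ((bS_bounds h a b (by omega)).2.2.1 h2).symm
  · exact ((bS_bounds h a b (by omega)).2.2.2 h3).symm
  · have := (bS_bounds h a b (by omega)).1
    rw [show s - 1 - (s - 1 - a) = a by omega]
    omega

theorem bf_bU {r s t : ℕ} (f : Fin r × Fin s → ℕ) : bf r s (bU r s t f) = f := by
  funext ⟨i, j⟩
  simp only [bU, bf]
  rw [if_neg (by omega), dif_neg (by omega), dif_neg (by omega), Nat.add_sub_cancel_left]
  congr 2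
  apply Fin.ext
  simp only
  omega

theorem bPP_finite (r s t : ℕ) : {f | bPP r s t f}.Finite := by
  refine (Set.Finite.pi' (fun _ : Fin r × Fin s => Set.finite_Iic t)).subset ?_
  intro f hf p
  exact hf.2 p

noncomputable def bF (r s t : ℕ) : Finset (Fin r × Fin s → ℕ) := (bPP_finite r s t).toFinset

theorem bgf (r s t : ℕ) : (PowerSeries.mk fun n => (PPbox n r s t : ℚ)) =
    ∑ f ∈ bF r s t, (PowerSeries.X : PowerSeries ℚ) ^ (∑ p, f p) := by
  classical
  ext n
  rw [PowerSeries.coeff_mk, map_sum]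
  simp only [PowerSeries.coeff_X_pow, Finset.sum_boole]
  rw [PPbox, ← Nat.subtype_card ((bF r s t).filter (fun f => n = ∑ p, f p))]
  intro f
  simp only [bF, Finset.mem_filter, Set.Finite.mem_toFinset, Set.mem_ofPred_eq, bPP]
  constructor
  · rintro ⟨h1, h2⟩
    exact ⟨h2.symm, h1⟩
  · rintro ⟨h1, h2⟩
    exact ⟨h2, h1.symm⟩

theorem bkey (r s t : ℕ) :
    PowerSeries.X ^ (bc r s + t * (∑ a ∈ Finset.range r, (r - 1 - a))) *
      (PowerSeries.mk fun n => (PPbox n r s t : ℚ)) * bD (s + r) =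
    bV (s + r) (fun i => bL s t i) := by
  obtain ⟨P, hP, hs⟩ := bmain (s + r) (fun i => bL s t i) (bL_mono s t _)
  rw [← hs, bgf, Finset.mul_sum]
  congr 1
  symm
  refine Finset.sum_bij' (fun U _ => bf r s U) (fun f _ => bU r s t f) ?_ ?_ ?_ ?_ ?_
  · intro U hU
    simpa [bF] using bf_PP ((hP U).1 hU)
  · intro f hf
    exact (hP _).2 (bU_S (by simpa [bF] using hf))
  · intro U hU
    exact bU_bf ((hP U).1 hU)
  · intro f hf
    exact bf_bU f
  · intro U hU
    rw [bwt_eq ((hP U).1 hU), pow_add]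

theorem bgf_zero (r s : ℕ) : (PowerSeries.mk fun n => (PPbox n r s 0 : ℚ)) = 1 := by
  have : bF r s 0 = {fun _ => 0} := by
    ext f
    simp only [bF, Set.Finite.mem_toFinset, Set.mem_ofPred_eq, bPP, Finset.mem_singleton]
    constructor
    · rintro ⟨-, h⟩
      funext p
      exact Nat.le_zero.1 (h p)
    · rintro rfl
      simp
  rw [bgf, this]
  simp

/-- MacMahon's box formula. -/
theorem macmahon_box_formula (r s t : ℕ) :
    (PowerSeries.mk fun n => (PPbox n r s t : ℚ)) *
      (∏ i ∈ Finset.Icc 1 r, ∏ j ∈ Finset.Icc 1 s,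
        (1 - (PowerSeries.X : PowerSeries ℚ) ^ (i + j - 1))) =
    ∏ i ∈ Finset.Icc 1 r, ∏ j ∈ Finset.Icc 1 s,
      (1 - (PowerSeries.X : PowerSeries ℚ) ^ (i + j + t - 1)) := by
  change _ * bN r s 0 = bN r s t
  obtain ⟨C, hC⟩ := bV_eval r s
  have h0 := bkey r s 0
  have ht := bkey r s t
  rw [bgf_zero, hC] at h0
  rw [hC] at ht
  simp only [zero_mul, add_zero, pow_zero, mul_one] at h0
  rw [pow_add] at ht
  have hX : ∀ k, (PowerSeries.X : PowerSeries ℚ) ^ k ≠ 0 := fun k => pow_ne_zero k PowerSeries.X_ne_zero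
  refine mul_left_cancel₀ (mul_ne_zero (mul_ne_zero (hX (bc r s))
    (hX (t * (∑ a ∈ Finset.range r, (r - 1 - a))))) (bD_ne (s + r))) ?_
  linear_combination bN r s 0 * ht - bN r s t *
    PowerSeries.X ^ (t * (∑ a ∈ Finset.range r, (r - 1 - a))) * h0
end

section
/- For every integer a ≥ 1, the generating function of plane partitions fitting inside a 2 × a rectangle equals F_a; that is, Σ_{k≥0} PP(k; 2, a)·x^k = F_a as formal power series over ℚ. -/
/-- The generating function `F_a = 1/((1−x)(1−x²)²⋯(1−x^a)²(1−x^{a+1}))`. -/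
noncomputable def Fgen (a : ℕ) : PowerSeries ℚ :=
  ((1 - PowerSeries.X) * (1 - PowerSeries.X ^ (a + 1)) *
    ∏ i ∈ Finset.Icc 2 a, (1 - PowerSeries.X ^ i) ^ 2)⁻¹

open PowerSeries in
/-- Generating function of partitions with at most `a` parts, each at most `p`. -/
noncomputable def uu : ℕ → ℕ → PowerSeries ℚ
  | 0, _ => 1
  | a + 1, p => ∑ i ∈ Finset.range (p + 1), X ^ i * uu a i

noncomputable def ww : ℕ → ℕ → PowerSeries ℚ
  | 0, _ => 0
  | a + 1, p => uu a (p + 1)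

noncomputable def vv : ℕ → ℕ → PowerSeries ℚ
  | _, 0 => 0
  | a, q + 1 => uu (a + 1) q

noncomputable def DD (a p q : ℕ) : PowerSeries ℚ :=
  uu a p * uu a q - PowerSeries.X * ww a p * vv a q

open PowerSeries

lemma uu_succ_zero (a : ℕ) : uu a 0 = 1 := by
  induction a with
  | zero => simp [uu]
  | succ a ih => simp [uu, ih]

lemma uu_succ_succ (a p : ℕ) : uu (a + 1) (p + 1) = uu (a + 1) p + X ^ (p + 1) * uu a (p + 1) := by
  simp only [uu]
  rw [Finset.sum_range_succ _ (p + 1)]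

lemma uu_ww (a p : ℕ) : uu a (p + 1) = uu a p + X ^ (p + 1) * ww a p := by
  cases a with
  | zero => simp [uu, ww]
  | succ a => rw [uu_succ_succ]; rfl

lemma vv_succ (a q : ℕ) : vv a (q + 1) = vv a q + X ^ q * uu a q := by
  cases q with
  | zero => simp [vv, uu]
  | succ q => simp only [vv]; rw [uu_succ_succ]

lemma uu_inner_sum (a q p : ℕ) (h : q ≤ p) :
    ∑ i ∈ Finset.Ioc q p, X ^ i * DD a i (q + 1) =
      uu (a + 1) p * uu a (q + 1) - uu a (p + 1) * uu (a + 1) q := by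
  induction p, h using Nat.le_induction with
  | base => simp; ring
  | succ p hp ih =>
    rw [Finset.sum_Ioc_succ_top (by omega), ih, uu_succ_succ a p, uu_ww a (p + 1), DD]
    simp only [vv]
    ring

lemma DD_rec (a p q : ℕ) (h : q ≤ p) :
    DD (a + 1) p q =
      ∑ j ∈ Finset.range (q + 1), ∑ i ∈ Finset.Icc j p, X ^ (i + j) * DD a i j := by
  induction q with
  | zero =>
    have : Finset.Icc 0 p = Finset.range (p + 1) := by ext; simp <;> omega
    simp [DD, vv, uu_succ_zero, this, uu]
  | succ q ih =>
    rw [Finset.sum_range_succ, ← ih (by omega)]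
    have h1 : Finset.Icc (q + 1) p = Finset.Ioc q p := by ext; simp <;> omega
    have h2 : ∑ i ∈ Finset.Icc (q + 1) p, X ^ (i + (q + 1)) * DD a i (q + 1) =
        X ^ (q + 1) * ∑ i ∈ Finset.Ioc q p, X ^ i * DD a i (q + 1) := by
      rw [h1, Finset.mul_sum]
      exact Finset.sum_congr rfl fun i _ => by ring
    rw [h2, uu_inner_sum a q p (by omega), DD, DD, uu_succ_succ a q, vv_succ (a + 1) q]
    simp only [ww]
    ring

/-- bounded two-row plane partitions, by columns -/
noncomputable def TT (a : ℕ) (b : ℕ × ℕ) : Finset (Fin a → ℕ × ℕ) :=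
  open Classical in
  (Fintype.piFinset fun _ => Finset.Iic b).filter
    fun c => Antitone c ∧ ∀ j, (c j).2 ≤ (c j).1

lemma mem_TT {a : ℕ} {b : ℕ × ℕ} {c : Fin a → ℕ × ℕ} :
    c ∈ TT a b ↔ (∀ j, c j ≤ b) ∧ Antitone c ∧ ∀ j, (c j).2 ≤ (c j).1 := by
  simp [TT]

noncomputable def HH (a : ℕ) (b : ℕ × ℕ) : PowerSeries ℚ :=
  ∑ c ∈ TT a b, X ^ (∑ j, ((c j).1 + (c j).2))

lemma cons_mem_TT {a : ℕ} {b m : ℕ × ℕ} {c : Fin a → ℕ × ℕ} :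
    (Fin.cons m c : Fin (a + 1) → ℕ × ℕ) ∈ TT (a + 1) b ↔ (m ≤ b ∧ m.2 ≤ m.1) ∧ c ∈ TT a m := by
  simp only [mem_TT, Fin.forall_fin_succ, Fin.cons_zero, Fin.cons_succ]
  constructor
  · rintro ⟨⟨h1, h2⟩, h3, h4, h5⟩
    refine ⟨⟨h1, h4⟩, ?_, ?_, h5⟩
    · intro j
      simpa using h3 (Fin.zero_le j.succ)
    · intro i j hij
      simpa using h3 (Fin.succ_le_succ_iff.2 hij)
  · rintro ⟨⟨h1, h4⟩, h2, h3, h5⟩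
    refine ⟨⟨h1, fun j => (h2 j).trans h1⟩, ?_, h4, h5⟩
    intro i j
    refine Fin.cases ?_ (fun i => ?_) i
    · refine Fin.cases ?_ (fun j => ?_) j
      · simp
      · intro _
        simpa using h2 j
    · refine Fin.cases ?_ (fun j => ?_) j
      · intro h
        simp at h
      · intro h
        simpa using h3 (Fin.succ_le_succ_iff.1 h)

lemma HH_rec (a : ℕ) (b : ℕ × ℕ) :
    HH (a + 1) b = ∑ m ∈ (Finset.Iic b).filter (fun m => m.2 ≤ m.1),
      X ^ (m.1 + m.2) * HH a m := by
  simp only [HH, Finset.mul_sum]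
  rw [Finset.sum_sigma']
  symm
  refine Finset.sum_bij' (fun x _ => (Fin.cons x.1 x.2 : Fin (a + 1) → ℕ × ℕ))
    (fun c _ => ⟨c 0, Fin.tail c⟩) ?_ ?_ ?_ ?_ ?_
  · rintro ⟨m, c⟩ h
    simp only [Finset.mem_sigma, Finset.mem_filter, Finset.mem_Iic] at h
    exact cons_mem_TT.2 h
  · intro c h
    simp only [Finset.mem_sigma, Finset.mem_filter, Finset.mem_Iic]
    rw [← Fin.cons_self_tail c] at h
    exact cons_mem_TT.1 h
  · rintro ⟨m, c⟩ h
    simp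
  · intro c h
    simp
  · rintro ⟨m, c⟩ h
    simp [Fin.sum_univ_succ, pow_add]

lemma HH_eq (a : ℕ) : ∀ p q : ℕ, q ≤ p → HH a (p, q) = DD a p q := by
  induction a with
  | zero =>
    intro p q h
    have : TT 0 (p, q) = Finset.univ := by
      ext c
      simp only [mem_TT, Finset.mem_univ, iff_true]
      exact ⟨fun j => j.elim0, fun j => j.elim0, fun j => j.elim0⟩
    simp [HH, DD, ww, uu, this]
  | succ a ih =>
    intro p q h
    rw [HH_rec, DD_rec a p q h, Finset.sum_sigma']
    refine Finset.sum_bij' (fun m _ => ⟨m.2, m.1⟩) (fun x _ => (x.2, x.1)) ?_ ?_ ?_ ?_ ?_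
    · rintro ⟨i, j⟩ h
      simp at h ⊢
      omega
    · rintro ⟨i, j⟩ h
      simp at h ⊢
      omega
    · rintro ⟨i, j⟩ h
      rfl
    · rintro ⟨i, j⟩ h
      rfl
    · rintro ⟨i, j⟩ h
      simp at h
      simp only
      rw [ih i j (by omega)]

noncomputable def EE (a : ℕ) : PowerSeries ℚ := ∏ i ∈ Finset.range a, (1 - X ^ (i + 1))

lemma uu_EE (a : ℕ) : ∀ p, uu a p * EE a = ∏ i ∈ Finset.range a, (1 - X ^ (p + i + 1)) := by
  induction a with
  | zero => simp [uu, EE]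
  | succ a ih =>
    intro p
    induction p with
    | zero => simp [uu_succ_zero, EE]
    | succ p ihp =>
      rw [uu_succ_succ, add_mul, ihp, Finset.prod_range_succ', Finset.prod_range_succ]
      have h1 := ih (p + 1)
      have h2 : EE (a + 1) = EE a * (1 - X ^ (a + 1)) := by
        simp [EE, Finset.prod_range_succ]
      have h3 : ∏ i ∈ Finset.range a, (1 - (X : PowerSeries ℚ) ^ (p + (i + 1) + 1)) =
          ∏ i ∈ Finset.range a, (1 - X ^ (p + 1 + i + 1)) :=
        Finset.prod_congr rfl fun i _ => by ring
      rw [h2, h3, ← h1]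
      ring

lemma uu_EE_mod (a p : ℕ) : ∃ r, uu a p * EE a = 1 + X ^ (p + 1) * r := by
  rw [uu_EE]
  induction a with
  | zero => exact ⟨0, by simp⟩
  | succ a ih =>
    obtain ⟨r, hr⟩ := ih
    rw [Finset.prod_range_succ, hr]
    exact ⟨r - X ^ a - X ^ (p + 1) * X ^ a * r, by ring⟩

lemma vv_EE_mod (a q : ℕ) : ∃ r, X * vv a q * EE (a + 1) = X + X ^ (q + 1) * r := by
  cases q with
  | zero => exact ⟨-1, by simp [vv]⟩
  | succ q =>
    obtain ⟨r, hr⟩ := uu_EE_mod (a + 1) q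
    exact ⟨r, by simp only [vv]; rw [mul_assoc, hr]; ring⟩

lemma DD_mod (b k : ℕ) :
    ∃ r, DD (b + 1) k k * (EE (b + 1) * EE (b + 2)) = (1 - X) + X ^ (k + 1) * r := by
  obtain ⟨r, hr⟩ := uu_EE_mod (b + 1) k
  obtain ⟨s, hs⟩ := uu_EE_mod b (k + 1)
  obtain ⟨t, ht⟩ := vv_EE_mod (b + 1) k
  have h1 : EE (b + 1) = EE b * (1 - X ^ (b + 1)) := by
    simp [EE, Finset.prod_range_succ]
  have h2 : EE (b + 2) = EE (b + 1) * (1 - X ^ (b + 2)) := by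
    simp [EE, Finset.prod_range_succ]
  have key : DD (b + 1) k k * (EE (b + 1) * EE (b + 2)) =
      (uu (b + 1) k * EE (b + 1)) ^ 2 * (1 - X ^ (b + 2)) -
      (uu b (k + 1) * EE b) * (X * vv (b + 1) k * EE (b + 1 + 1)) * (1 - X ^ (b + 1)) := by
    simp only [DD, ww]
    rw [show b + 1 + 1 = b + 2 from rfl, h2, h1]
    ring
  rw [key, hr, hs, ht]
  exact ⟨(2 * r + X ^ (k + 1) * r ^ 2) * (1 - X ^ (b + 2)) -
    (t + X * s * X + X ^ (k + 1 + 1) * s * t) * (1 - X ^ (b + 1)), by ring⟩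

lemma EE_den (b : ℕ) : EE (b + 1) * EE (b + 2) = (1 - X) * ((1 - X) * (1 - X ^ (b + 1 + 1)) *
    ∏ i ∈ Finset.Icc 2 (b + 1), (1 - X ^ i) ^ 2) := by
  induction b with
  | zero => simp [EE, Finset.prod_range_succ]
  | succ b ih =>
    rw [Finset.prod_Icc_succ_top (by omega)]
    have h1 : ∀ b, EE (b + 1) = EE b * (1 - X ^ (b + 1)) := by
      simp [EE, Finset.prod_range_succ]
    rw [show b + 1 + 2 = b + 2 + 1 from rfl, h1 (b + 2), show b + 1 + 1 = b + 2 from rfl]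
    have h2 : EE (b + 2) = EE (b + 1) * (1 - X ^ (b + 2)) := h1 (b + 1)
    linear_combination (1 - X ^ (b + 2)) * (1 - X ^ (b + 3)) * ih + (1 - X ^ (b + 3)) * EE (b + 2) * h2

lemma PP_eq (k a : ℕ) : (PP k 2 a : ℚ) = coeff k (HH a (k, k)) := by
  classical
  simp only [HH, map_sum, coeff_X_pow, Finset.sum_boole]
  norm_cast
  rw [PP, ← Fintype.card_coe, ← Nat.card_eq_fintype_card]
  refine Nat.card_congr
    { toFun := fun f => ⟨fun j => (f.1 (0, j), f.1 (1, j)), ?_⟩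
      invFun := fun c => ⟨fun x => if x.1 = 0 then (c.1 x.2).1 else (c.1 x.2).2, ?_⟩
      left_inv := ?_
      right_inv := ?_ }
  · obtain ⟨f, hf, hm⟩ := f
    have hb : ∀ x, f x ≤ k := fun x => by
      rw [← hf]
      exact Finset.single_le_sum (fun _ _ => Nat.zero_le _) (Finset.mem_univ x)
    rw [Finset.mem_filter, mem_TT]
    refine ⟨⟨fun j => ⟨hb _, hb _⟩, fun i j hij => ⟨hm _ _ le_rfl hij, hm _ _ le_rfl hij⟩,
      fun j => hm _ _ (by simp) le_rfl⟩, ?_⟩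
    refine hf.symm.trans ?_
    dsimp only
    rw [Fintype.sum_prod_type, Fin.sum_univ_two, Finset.sum_add_distrib]
  · obtain ⟨c, hc⟩ := c
    rw [Finset.mem_filter, mem_TT] at hc
    obtain ⟨⟨-, hm, hd⟩, hs⟩ := hc
    refine ⟨?_, ?_⟩
    · refine Eq.trans ?_ hs.symm
      rw [Fintype.sum_prod_type, Fin.sum_univ_two, Finset.sum_add_distrib]
      simp
    · rintro ⟨i, j⟩ ⟨i', j'⟩ hi hj
      have h1 := (hm hj).1
      have h2 := (hm hj).2
      have h3 := hd j
      have h4 := hd j'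
      simp only at hi hj h1 h2 h3 h4 ⊢
      split_ifs <;> omega
  · rintro ⟨f, hf⟩
    ext ⟨i, j⟩
    fin_cases i <;> simp
  · rintro ⟨c, hc⟩
    ext j <;> simp

theorem planePartitions_two_by_a_genFun (a : ℕ) (ha : 1 ≤ a) :
    PowerSeries.mk (fun k => (PP k 2 a : ℚ)) = Fgen a := by
  obtain ⟨b, rfl⟩ : ∃ b, a = b + 1 := ⟨a - 1, by omega⟩
  ext k
  rw [coeff_mk, PP_eq, HH_eq _ _ _ le_rfl, Fgen]
  obtain ⟨r, hr⟩ := DD_mod b k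
  rw [EE_den] at hr
  set den : PowerSeries ℚ := ((1 - X) * (1 - X ^ (b + 1 + 1)) *
    ∏ i ∈ Finset.Icc 2 (b + 1), (1 - X ^ i) ^ 2) with hden
  have h0 : constantCoeff den ≠ 0 := by
    simp only [hden, map_mul, map_sub, map_one, map_prod, map_pow, constantCoeff_X]
    refine mul_ne_zero (by simp) (Finset.prod_ne_zero_iff.2 fun i hi => ?_)
    have : i ≠ 0 := by simp at hi; omega
    simp [this]
  have h1 : constantCoeff (1 - X : PowerSeries ℚ) ≠ 0 := by simp
  have e0 := PowerSeries.mul_inv_cancel den h0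
  have e1 := PowerSeries.mul_inv_cancel (1 - X : PowerSeries ℚ) h1
  have : DD (b + 1) k k = den⁻¹ + X ^ (k + 1) * (r * den⁻¹ * (1 - X)⁻¹) := by
    linear_combination den⁻¹ * (1 - X)⁻¹ * hr + (den⁻¹ - DD (b + 1) k k * den * den⁻¹) * e1 -
      DD (b + 1) k k * e0
  rw [this, map_add, coeff_X_pow_mul']
  simp
end

section
/- Let a ≥ 2, j ≥ 0 and k ≥ 2j with k ≥ 1. The total number of Kronecker tableaux of shape (3k, k^a)/α and type (2k+j, 2k−j, k^{a−1})/α, summed over all partitions α of k with at most a+1 parts, equals the number of coloured partitions of j with parts in C_a. In particular, this count is independent of k for k ≥ 2j. -/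
/-- Number of coloured partitions of `j` with parts in
`C_a = {1, 1̄, 2, 2̄, 2̿, …, a−1, (a−1)‾, (a−1)̿, a, ā, a+1}`: the unbarred colours
have weights `1, …, a+1` (indexed by `Fin (a+1)`, index `i` having weight `i+1`), the
barred colours have weights `1, …, a` (indexed by `Fin a`, index `i` having weight
`i+1`), and the doubly-barred colours have weights `2, …, a−1` (indexed by
`Fin (a−2)`, index `i` having weight `i+2`). -/
noncomputable def colouredC (a j : ℕ) : ℕ :=
  Nat.card {t : (Fin (a + 1) → ℕ) × (Fin a → ℕ) × (Fin (a - 2) → ℕ) //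
    (∑ i : Fin (a + 1), ((i : ℕ) + 1) * t.1 i) +
      (∑ i : Fin a, ((i : ℕ) + 1) * t.2.1 i) +
      (∑ i : Fin (a - 2), ((i : ℕ) + 2) * t.2.2 i) = j}

/-- The cells of the skew shape `λ/α`, with rows and columns indexed from `0`:
cell `(i, j)` belongs to `λ/α` iff `α i ≤ j < λ i`. -/
def skewCells (lam alpha : ℕ → ℕ) : Set (ℕ × ℕ) :=
  {p | alpha p.1 ≤ p.2 ∧ p.2 < lam p.1}

/-- The number of cells of `S` in which the filling `T` has entry `v`. -/
noncomputable def entryCount (T : ℕ × ℕ → ℕ) (S : Set (ℕ × ℕ)) (v : ℕ) : ℕ :=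
  Nat.card {p : ℕ × ℕ // p ∈ S ∧ T p = v}

/-- The set of cells giving an initial segment of the reverse reading word of a
filling of `λ/α` (rows read right to left, from the top row downwards): all cells in
rows `< r`, together with the cells in row `r` lying in columns `≥ c`. -/
def rrwPrefix (lam alpha : ℕ → ℕ) (r c : ℕ) : Set (ℕ × ℕ) :=
  {p | p ∈ skewCells lam alpha ∧ (p.1 < r ∨ (p.1 = r ∧ c ≤ p.2))}

/-- `T` is a Kronecker tableau of shape `λ/α` and type `ν/α` (all partitions indexed
from `0`, so `lam 0` is the first part, etc.; `T` is required to vanish outside the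
skew shape):
* `α ⊆ λ ∩ ν`;
* `T` is a semistandard filling: positive entries, weakly increasing along rows,
  strictly increasing down columns;
* the entry `v+1` occurs exactly `ν_{v+1} − α_{v+1}` times (type condition);
* every initial segment of the reverse reading word is an `α`-lattice permutation;
* the `α`-condition: `α₁ = α₂`, or `α₁ > α₂` and (the number of `1`'s in the second
  row equals `α₁ − α₂`, or the number of `2`'s in the first row equals `α₁ − α₂`). -/
def IsKroneckerTableau (lam nu alpha : ℕ → ℕ) (T : ℕ × ℕ → ℕ) : Prop :=
  (∀ i, alpha i ≤ lam i ∧ alpha i ≤ nu i) ∧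
  (∀ p, p ∉ skewCells lam alpha → T p = 0) ∧
  (∀ p ∈ skewCells lam alpha, 1 ≤ T p) ∧
  (∀ i j j', (i, j) ∈ skewCells lam alpha → (i, j') ∈ skewCells lam alpha → j ≤ j' →
    T (i, j) ≤ T (i, j')) ∧
  (∀ i i' j, (i, j) ∈ skewCells lam alpha → (i', j) ∈ skewCells lam alpha → i < i' →
    T (i, j) < T (i', j)) ∧
  (∀ v : ℕ, entryCount T (skewCells lam alpha) (v + 1) = nu v - alpha v) ∧
  (∀ r c v : ℕ,
    entryCount T (rrwPrefix lam alpha r c) (v + 2) + alpha (v + 1) ≤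
      entryCount T (rrwPrefix lam alpha r c) (v + 1) + alpha v) ∧
  (alpha 0 = alpha 1 ∨
    (alpha 1 < alpha 0 ∧
      (entryCount T {p | p ∈ skewCells lam alpha ∧ p.1 = 1} 1 = alpha 0 - alpha 1 ∨
        entryCount T {p | p ∈ skewCells lam alpha ∧ p.1 = 0} 2 = alpha 0 - alpha 1)))

/-- The partition `(c, k, k, …, k)` with `a` copies of `k`, as a function `ℕ → ℕ`
indexed from `0`. -/
def hookRect (c k a : ℕ) : ℕ → ℕ :=
  fun i => if i = 0 then c else if i < a + 1 then k else 0

/-- Row counts: number of cells of row `i` with entry `v`. -/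
def kfRC (lam alpha : ℕ → ℕ) (T : ℕ × ℕ → ℕ) (i v : ℕ) : ℕ :=
  ((Finset.Ico (alpha i) (lam i)).filter (fun c => T (i, c) = v)).card

theorem kf_entryCount (T : ℕ × ℕ → ℕ) (S : Set (ℕ × ℕ)) (R v : ℕ) (F : ℕ → Finset ℕ)
    (hF : ∀ i c, i < R → (c ∈ F i ↔ (i, c) ∈ S ∧ T (i, c) = v)) (hR : ∀ p ∈ S, p.1 < R) :
    entryCount T S v = ∑ i ∈ Finset.range R, (F i).card := by
  unfold entryCount
  rw [Nat.subtype_card ((Finset.range R).biUnion (fun i => (F i).image (fun c => (i, c))))]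
  · rw [Finset.card_biUnion]
    · refine Finset.sum_congr rfl fun i _ => ?_
      rw [Finset.card_image_of_injective]
      intro c d h
      simpa using h
    · intro i _ i' _ hne
      simp only [Function.onFun]
      rw [Finset.disjoint_left]
      rintro ⟨p, q⟩ h1 h2
      simp only [Finset.mem_image, Prod.mk.injEq] at h1 h2
      obtain ⟨_, _, h1, _⟩ := h1
      obtain ⟨_, _, h2, _⟩ := h2
      exact hne (h1.trans h2.symm)
  · rintro ⟨p, q⟩
    simp only [Finset.mem_biUnion, Finset.mem_range, Finset.mem_image, Prod.mk.injEq]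
    constructor
    · rintro ⟨i, hi, c, h, rfl, rfl⟩
      exact (hF i c hi).1 h
    · rintro ⟨h1, h2⟩
      exact ⟨p, hR _ h1, q, (hF p q (hR _ h1)).2 ⟨h1, h2⟩, rfl, rfl⟩

theorem kf_ec_all (lam alpha : ℕ → ℕ) (T : ℕ × ℕ → ℕ) (R v : ℕ)
    (hR : ∀ i, R ≤ i → lam i = 0) :
    entryCount T (skewCells lam alpha) v = ∑ i ∈ Finset.range R, kfRC lam alpha T i v := by
  refine kf_entryCount T _ R v _ ?_ ?_
  · intro i c _
    simp only [Finset.mem_filter, Finset.mem_Ico, skewCells, Set.mem_ofPred_eq]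
  · rintro ⟨p, q⟩ h
    by_contra h'
    have := hR p (by simpa using h')
    simp [skewCells, this] at h

theorem kf_ec_row (lam alpha : ℕ → ℕ) (T : ℕ × ℕ → ℕ) (r v : ℕ) :
    entryCount T {p | p ∈ skewCells lam alpha ∧ p.1 = r} v = kfRC lam alpha T r v := by
  rw [kf_entryCount T _ (r + 1) v
    (fun i => if i = r then (Finset.Ico (alpha i) (lam i)).filter (fun c => T (i, c) = v) else ∅)]
  · rw [Finset.sum_range_succ, Finset.sum_eq_zero]
    · simp [kfRC]
    · intro i hi
      have hi := Finset.mem_range.1 hi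
      have : i ≠ r := by omega
      simp [this]
  · intro i c _
    by_cases h : i = r <;> simp [h, skewCells]
  · rintro p h
    have := h.2
    omega

theorem kf_ec_init (lam alpha : ℕ → ℕ) (T : ℕ × ℕ → ℕ) (r c v : ℕ) :
    entryCount T (rrwPrefix lam alpha r c) v = ∑ i ∈ Finset.range r, kfRC lam alpha T i v +
      ((Finset.Ico (alpha r) (lam r)).filter (fun d => c ≤ d ∧ T (r, d) = v)).card := by
  rw [kf_entryCount T _ (r + 1) v
    (fun i => (Finset.Ico (alpha i) (lam i)).filter (fun d => (i = r → c ≤ d) ∧ T (i, d) = v))]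
  · rw [Finset.sum_range_succ]
    congr 1
    · refine Finset.sum_congr rfl fun i hi => ?_
      have hi := Finset.mem_range.1 hi
      have : i ≠ r := by omega
      simp [this, kfRC]
    · simp
  · intro i d hi
    simp only [Finset.mem_filter, Finset.mem_Ico, skewCells, rrwPrefix, Set.mem_ofPred_eq]
    by_cases h : i = r
    · simp [h, and_assoc]
    · have : i < r := by omega
      simp [h, this]
  · rintro p h
    have := h.2
    omega

theorem kf_latt_fwd (lam alpha : ℕ → ℕ) (T : ℕ × ℕ → ℕ)
    (hrow : ∀ i j j', (i, j) ∈ skewCells lam alpha → (i, j') ∈ skewCells lam alpha → j ≤ j' →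
      T (i, j) ≤ T (i, j'))
    (hl : ∀ r c v : ℕ,
      entryCount T (rrwPrefix lam alpha r c) (v + 2) + alpha (v + 1) ≤
        entryCount T (rrwPrefix lam alpha r c) (v + 1) + alpha v) (r v : ℕ) :
    ∑ i ∈ Finset.range (r + 1), kfRC lam alpha T i (v + 2) + alpha (v + 1) ≤
      ∑ i ∈ Finset.range r, kfRC lam alpha T i (v + 1) + alpha v := by
  classical
  have hex : ∃ c, ∀ d, alpha r ≤ d → d < lam r → c ≤ d → v + 2 ≤ T (r, d) :=
    ⟨lam r, fun d _ h1 h2 => by omega⟩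
  have h := hl r (Nat.find hex) v
  rw [kf_ec_init, kf_ec_init] at h
  have h1 : ((Finset.Ico (alpha r) (lam r)).filter
      (fun d => Nat.find hex ≤ d ∧ T (r, d) = v + 2)).card = kfRC lam alpha T r (v + 2) := by
    unfold kfRC
    congr 1
    ext d
    simp only [Finset.mem_filter, Finset.mem_Ico]
    constructor
    · tauto
    · rintro ⟨⟨h1, h2⟩, h3⟩
      refine ⟨⟨h1, h2⟩, Nat.find_min' hex ?_, h3⟩
      intro d' h4 h5 h6
      rw [← h3]
      exact hrow r d d' ⟨h1, h2⟩ ⟨h4, h5⟩ h6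
  have h2 : ((Finset.Ico (alpha r) (lam r)).filter
      (fun d => Nat.find hex ≤ d ∧ T (r, d) = v + 1)).card = 0 := by
    rw [Finset.card_eq_zero, Finset.filter_eq_empty_iff]
    rintro d hd ⟨h3, h4⟩
    have hd := Finset.mem_Ico.1 hd
    have := Nat.find_spec hex d hd.1 hd.2 h3
    omega
  rw [h1, h2] at h
  rw [Finset.sum_range_succ]
  omega

theorem kf_latt_bwd (lam alpha : ℕ → ℕ) (T : ℕ × ℕ → ℕ)
    (hl : ∀ r v, ∑ i ∈ Finset.range (r + 1), kfRC lam alpha T i (v + 2) + alpha (v + 1) ≤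
      ∑ i ∈ Finset.range r, kfRC lam alpha T i (v + 1) + alpha v) (r c v : ℕ) :
    entryCount T (rrwPrefix lam alpha r c) (v + 2) + alpha (v + 1) ≤
        entryCount T (rrwPrefix lam alpha r c) (v + 1) + alpha v := by
  have h := hl r v
  rw [kf_ec_init, kf_ec_init]
  rw [Finset.sum_range_succ] at h
  have h1 : ((Finset.Ico (alpha r) (lam r)).filter
      (fun d => c ≤ d ∧ T (r, d) = v + 2)).card ≤ kfRC lam alpha T r (v + 2) := by
    unfold kfRC
    apply Finset.card_le_card
    intro d
    simp only [Finset.mem_filter]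
    tauto
  omega

theorem kf_row_aux (A B : ℕ) (f g : ℕ → ℕ)
    (hg : ∀ c d, A ≤ c → d < B → c ≤ d → g c ≤ g d)
    (h : ∀ v, ((Finset.Ico A B).filter (fun c => f c = v)).card =
      ((Finset.Ico A B).filter (fun c => g c = v)).card)
    (c : ℕ) (hA : A ≤ c) (hB : c < B) (hlt : ∀ d, A ≤ d → d < c → f d = g d) : ¬ f c < g c := by
  intro hc
  have h1 : (Finset.Ico A B).filter (fun d => g d = f c) ⊂
      (Finset.Ico A B).filter (fun d => f d = f c) := by
    rw [Finset.ssubset_iff_of_subset]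
    · refine ⟨c, ?_, ?_⟩
      · simp [hA, hB]
      · simp only [Finset.mem_filter, not_and]
        intro _
        omega
    · intro d
      simp only [Finset.mem_filter, Finset.mem_Ico]
      rintro ⟨⟨h1, h2⟩, h3⟩
      refine ⟨⟨h1, h2⟩, ?_⟩
      by_cases hdc : d < c
      · rw [hlt d h1 hdc, h3]
      · have := hg c d hA h2 (by omega)
        omega
  have := Finset.card_lt_card h1
  have := h (f c)
  omega

theorem kf_row_unique (A B : ℕ) (f g : ℕ → ℕ)
    (hf : ∀ c d, A ≤ c → d < B → c ≤ d → f c ≤ f d)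
    (hg : ∀ c d, A ≤ c → d < B → c ≤ d → g c ≤ g d)
    (h : ∀ v, ((Finset.Ico A B).filter (fun c => f c = v)).card =
      ((Finset.Ico A B).filter (fun c => g c = v)).card)
    (c : ℕ) (hA : A ≤ c) (hB : c < B) : f c = g c := by
  induction c using Nat.strong_induction_on with
  | _ c ih =>
    have hlt : ∀ d, A ≤ d → d < c → f d = g d := fun d h1 h2 => ih d h2 h1 (by omega)
    have h1 := kf_row_aux A B f g hg h c hA hB hlt
    have h2 := kf_row_aux A B g f hf (fun v => (h v).symm) c hA hB
      (fun d h1 h2 => (hlt d h1 h2).symm)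
    omega

/-- Partial sums of row contents. -/
def kfS (A : ℕ) (n : ℕ → ℕ) (v : ℕ) : ℕ := A + ∑ u ∈ Finset.range (v + 1), n u

/-- Sorted filling of a row starting in column `A` with content `n`. -/
def kfFill (A : ℕ) (n : ℕ → ℕ) (K c : ℕ) : ℕ :=
  ((Finset.range K).filter (fun u => kfS A n u ≤ c)).card

theorem kfS_mono (A : ℕ) (n : ℕ → ℕ) {u v : ℕ} (h : u ≤ v) : kfS A n u ≤ kfS A n v := by
  unfold kfS
  have : Finset.range (u + 1) ⊆ Finset.range (v + 1) := by
    intro x; simp only [Finset.mem_range]; omega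
  have := Finset.sum_le_sum_of_subset (f := n) this
  omega

theorem kfFill_iff (A : ℕ) (n : ℕ → ℕ) (K c v : ℕ) (hv : v < K) :
    v + 1 ≤ kfFill A n K c ↔ kfS A n v ≤ c := by
  constructor
  · intro h
    by_contra h'
    have : (Finset.range K).filter (fun u => kfS A n u ≤ c) ⊆ Finset.range v := by
      intro u
      simp only [Finset.mem_filter, Finset.mem_range]
      rintro ⟨_, h2⟩
      by_contra h3
      have := kfS_mono A n (u := v) (v := u) (by omega)
      omega
    have := Finset.card_le_card this
    rw [Finset.card_range] at this
    unfold kfFill at h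
    omega
  · intro h
    have : Finset.range (v + 1) ⊆ (Finset.range K).filter (fun u => kfS A n u ≤ c) := by
      intro u
      simp only [Finset.mem_filter, Finset.mem_range]
      intro h2
      have := kfS_mono A n (u := u) (v := v) (by omega)
      omega
    have := Finset.card_le_card this
    rw [Finset.card_range] at this
    exact this

theorem kfFill_mono (A : ℕ) (n : ℕ → ℕ) (K : ℕ) {c d : ℕ} (h : c ≤ d) :
    kfFill A n K c ≤ kfFill A n K d := by
  unfold kfFill
  apply Finset.card_le_card
  intro u
  simp only [Finset.mem_filter, Finset.mem_range]
  omega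

theorem kfFill_count (A B a : ℕ) (n : ℕ → ℕ) (h0 : n 0 = 0) (hv : ∀ v, a + 2 ≤ v → n v = 0)
    (hB : kfS A n (a + 1) = B) (v : ℕ) :
    ((Finset.Ico A B).filter (fun c => kfFill A n (a + 2) c = v)).card = n v := by
  have hS0 : kfS A n 0 = A := by simp [kfS, h0]
  rcases v with _ | v
  · rw [h0, Finset.card_eq_zero, Finset.filter_eq_empty_iff]
    intro c hc h
    have hc := Finset.mem_Ico.1 hc
    have := (kfFill_iff A n (a + 2) c 0 (by omega)).2 (by omega)
    omega
  · by_cases h : v + 1 < a + 2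
    · have : (Finset.Ico A B).filter (fun c => kfFill A n (a + 2) c = v + 1) =
          Finset.Ico (kfS A n v) (kfS A n (v + 1)) := by
        ext c
        simp only [Finset.mem_filter, Finset.mem_Ico]
        have h1 := kfFill_iff A n (a + 2) c v (by omega)
        have h2 := kfFill_iff A n (a + 2) c (v + 1) (by omega)
        have h3 := kfS_mono A n (u := 0) (v := v) (by omega)
        have h4 := kfS_mono A n (u := v + 1) (v := a + 1) (by omega)
        omega
      rw [this, Nat.card_Ico]
      unfold kfS
      rw [Finset.sum_range_succ (n := v + 1)]
      omega
    · rw [hv _ (by omega), Finset.card_eq_zero, Finset.filter_eq_empty_iff]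
      intro c hc h
      have hc := Finset.mem_Ico.1 hc
      have := kfFill_iff A n (a + 2) c (a + 1) (by omega)
      omega

/-- Parameter triples `(E, X, Y)`. -/
def kfQ (a j : ℕ) (q : (ℕ → ℕ) × (ℕ → ℕ) × (ℕ → ℕ)) : Prop :=
  (∀ i, a ≤ i → q.1 i = 0) ∧ (∀ i, a ≤ i → q.2.1 i = 0) ∧ (∀ i, a ≤ i + 1 → q.2.2 i = 0) ∧
  ∑ i ∈ Finset.range a, ((i + 2) * q.1 i + (i + 1) * q.2.1 i + (i + 1) * q.2.2 i) = j

/-- From parameter triples to coloured partitions. -/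
def kfToCol (n : ℕ) (q : (ℕ → ℕ) × (ℕ → ℕ) × (ℕ → ℕ)) :
    (Fin (n + 2 + 1) → ℕ) × (Fin (n + 2) → ℕ) × (Fin (n + 2 - 2) → ℕ) :=
  (Fin.cons (q.2.2 0) (fun i => q.1 i), fun i => q.2.1 i, fun i => q.2.2 (i + 1))

theorem kf_col_sum (n : ℕ) (q : (ℕ → ℕ) × (ℕ → ℕ) × (ℕ → ℕ))
    (h3 : ∀ i, n + 2 ≤ i + 1 → q.2.2 i = 0) :
    (∑ i : Fin (n + 2 + 1), ((i : ℕ) + 1) * (kfToCol n q).1 i) +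
      (∑ i : Fin (n + 2), ((i : ℕ) + 1) * (kfToCol n q).2.1 i) +
      (∑ i : Fin (n + 2 - 2), ((i : ℕ) + 2) * (kfToCol n q).2.2 i) =
    ∑ i ∈ Finset.range (n + 2),
      ((i + 2) * q.1 i + (i + 1) * q.2.1 i + (i + 1) * q.2.2 i) := by
  rw [Finset.sum_add_distrib, Finset.sum_add_distrib]
  have e1 : (∑ i : Fin (n + 2 + 1), ((i : ℕ) + 1) * (kfToCol n q).1 i) =
      q.2.2 0 + ∑ i ∈ Finset.range (n + 2), (i + 2) * q.1 i := by
    rw [Fin.sum_univ_succ, ← Fin.sum_univ_eq_sum_range (fun i => (i + 2) * q.1 i)]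
    simp [kfToCol]
  have e2 : (∑ i : Fin (n + 2), ((i : ℕ) + 1) * (kfToCol n q).2.1 i) =
      ∑ i ∈ Finset.range (n + 2), (i + 1) * q.2.1 i := by
    rw [← Fin.sum_univ_eq_sum_range (fun i => (i + 1) * q.2.1 i)]
    simp [kfToCol]
  have e3 : (∑ i : Fin (n + 2 - 2), ((i : ℕ) + 2) * (kfToCol n q).2.2 i) =
      ∑ i ∈ Finset.range n, (i + 2) * q.2.2 (i + 1) := by
    rw [← Fin.sum_univ_eq_sum_range (fun i => (i + 2) * q.2.2 (i + 1))]
    rfl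
  have e4 : ∑ i ∈ Finset.range (n + 2), (i + 1) * q.2.2 i =
      q.2.2 0 + ∑ i ∈ Finset.range n, (i + 2) * q.2.2 (i + 1) := by
    rw [Finset.sum_range_succ, h3 (n + 1) (by omega), Finset.sum_range_succ']
    simp only [add_assoc, one_add_one_eq_two]
    ring
  rw [e1, e2, e3, e4]
  ring

theorem kf_coloured (n j : ℕ) :
    colouredC (n + 2) j = Nat.card {q // kfQ (n + 2) j q} := by
  unfold colouredC
  symm
  refine Nat.card_eq_of_bijective (fun q => ⟨kfToCol n q.1, ?_⟩) ⟨?_, ?_⟩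
  · rw [kf_col_sum n q.1 q.2.2.2.1]
    exact q.2.2.2.2
  · rintro ⟨⟨E, X, Y⟩, h1, h2, h3, h4⟩ ⟨⟨E', X', Y'⟩, h1', h2', h3', h4'⟩ h
    simp only [Subtype.mk.injEq, kfToCol, Prod.mk.injEq] at h
    obtain ⟨ha, hb, hc⟩ := h
    rw [Fin.cons_inj] at ha
    simp only at h1 h2 h3 h1' h2' h3'
    have hE : E = E' := by
      funext i
      by_cases hi : i < n + 2
      · exact congrFun ha.2 ⟨i, hi⟩
      · rw [h1 i (by omega), h1' i (by omega)]
    have hX : X = X' := by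
      funext i
      by_cases hi : i < n + 2
      · exact congrFun hb ⟨i, hi⟩
      · rw [h2 i (by omega), h2' i (by omega)]
    have hY : Y = Y' := by
      funext i
      rcases i with _ | i
      · exact ha.1
      · by_cases hi : i < n
        · exact congrFun hc ⟨i, hi⟩
        · rw [h3 _ (by omega), h3' _ (by omega)]
    subst hE hX hY
    rfl
  · rintro ⟨⟨p, q, r⟩, h⟩
    let E : ℕ → ℕ := fun i => if hi : i < n + 2 then p (Fin.succ ⟨i, hi⟩) else 0
    let X : ℕ → ℕ := fun i => if hi : i < n + 2 then q ⟨i, hi⟩ else 0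
    let Y : ℕ → ℕ := fun i => if i = 0 then p 0 else if hi : i - 1 < n then r ⟨i - 1, hi⟩ else 0
    have hY : ∀ i, n + 2 ≤ i + 1 → Y i = 0 := by
      intro i hi
      have h1 : i ≠ 0 := by omega
      have h2 : ¬ (i - 1 < n) := by omega
      simp [Y, h1, h2]
    have hcol : kfToCol n (E, X, Y) = (p, q, r) := by
      simp only [kfToCol, Prod.mk.injEq]
      refine ⟨?_, ?_, ?_⟩
      · funext i
        refine Fin.cases ?_ (fun i => ?_) i
        · simp [Y]
        · have : (⟨(i : ℕ), i.2⟩ : Fin (n + 2)) = i := rfl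
          simp only [Fin.cons_succ, E, i.2, dite_true]
      · funext i
        simp [X]
      · funext i
        have : (i : ℕ) < n := i.2
        simp [Y, this]
    refine ⟨⟨(E, X, Y), ?_, ?_, hY, ?_⟩, ?_⟩
    · intro i hi
      have h2 : ¬ (i < n + 2) := by omega
      simp [E, h2]
    · intro i hi
      have h2 : ¬ (i < n + 2) := by omega
      simp [X, h2]
    · rw [← kf_col_sum n (E, X, Y) hY, hcol]
      exact h
    · exact Subtype.ext hcol

theorem kf_abel (b e : ℕ → ℕ) (n : ℕ) (h : ∀ i, i < n → b i = e i + b (i + 1)) :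
    ∑ i ∈ Finset.range n, b i = ∑ i ∈ Finset.range n, (i + 1) * e i + n * b n := by
  induction n with
  | zero => simp
  | succ n ih =>
    rw [Finset.sum_range_succ, Finset.sum_range_succ, ih (fun i hi => h i (by omega)),
      h n (by omega)]
    ring

theorem kf_tele (b e : ℕ → ℕ) (n : ℕ) (h : ∀ i, i < n → b i = e i + b (i + 1)) :
    b 0 = ∑ i ∈ Finset.range n, e i + b n := by
  induction n with
  | zero => simp
  | succ n ih =>
    rw [Finset.sum_range_succ, ih (fun i hi => h i (by omega)), h n (by omega)]
    ring

/-- The key weight identity. -/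
theorem kf_weight (a : ℕ) (E X Y b : ℕ → ℕ) (hX : X a = 0) (hb : b a = 0)
    (h : ∀ i, i < a → b i = E i + X (i + 1) + Y i + b (i + 1)) :
    ∑ i ∈ Finset.range a, b i + b 0 + X 0 =
      ∑ i ∈ Finset.range a, ((i + 2) * E i + (i + 1) * X i + (i + 1) * Y i) +
        ∑ i ∈ Finset.range a, Y i := by
  have h1 := kf_abel b (fun i => E i + X (i + 1) + Y i) a h
  have h2 := kf_tele b (fun i => E i + X (i + 1) + Y i) a h
  rw [hb] at h1 h2
  have h3 : ∑ i ∈ Finset.range a, (i + 2) * X (i + 1) + X 0 =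
      ∑ i ∈ Finset.range a, (i + 1) * X i := by
    have := Finset.sum_range_succ (fun i => (i + 1) * X i) a
    rw [Finset.sum_range_succ'] at this
    simp only [hX] at this
    simp only [add_assoc, one_add_one_eq_two] at this
    simpa using this
  rw [h1, h2]
  simp only [mul_zero, add_zero]
  have h4 : ∑ i ∈ Finset.range a, (i + 1) * (E i + X (i + 1) + Y i) +
      ∑ i ∈ Finset.range a, (E i + X (i + 1) + Y i) =
      ∑ i ∈ Finset.range a, (i + 2) * E i + ∑ i ∈ Finset.range a, (i + 2) * X (i + 1) +
      ∑ i ∈ Finset.range a, (i + 1) * Y i + ∑ i ∈ Finset.range a, Y i := by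
    simp only [← Finset.sum_add_distrib]
    refine Finset.sum_congr rfl fun i _ => ?_
    ring
  rw [h4, Finset.sum_add_distrib, Finset.sum_add_distrib, ← h3]
  ring

/-- The type `ν`. -/
def kfNu (a j k : ℕ) : ℕ → ℕ := fun t => if t = 0 then 2 * k + j else if t = 1 then 2 * k - j
  else if t < a + 1 then k else 0

/-- The row content matrix. -/
def kfN (a k : ℕ) (α X Y : ℕ → ℕ) : ℕ → ℕ → ℕ
  | 0, 0 => 0
  | 0, 1 => 3 * k - α 0 - (α 0 - α 1) - ∑ i ∈ Finset.range a, (X (i + 1) + Y i)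
  | 0, 2 => α 0 - α 1
  | 0, v + 3 => X (v + 1) + Y v
  | 1, 0 => 0
  | 1, 1 => X 0
  | 1, 2 => k - α 1 - X 0
  | 1, _ + 3 => 0
  | _ + 2, 0 => 0
  | i + 2, 1 => X (i + 1)
  | i + 2, 2 => Y i
  | i + 2, v + 3 => if v = i ∧ i + 1 < a then k - α (i + 2) - X (i + 1) - Y i else 0

/-- The conditions on `α` and the parameters. -/
structure KfGood (a j k : ℕ) (α X Y : ℕ → ℕ) : Prop where
  anti : ∀ i, α (i + 1) ≤ α i
  zero : ∀ i, a + 1 ≤ i → α i = 0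
  sum : ∑ i ∈ Finset.range (a + 1), α i = k
  hX : ∀ i, a ≤ i → X i = 0
  hY : ∀ i, a ≤ i + 1 → Y i = 0
  step : ∀ i, X (i + 1) + Y i + α (i + 2) ≤ α (i + 1)
  wt : ∑ i ∈ Finset.range a, α (i + 1) + α 1 + X 0 = j + ∑ i ∈ Finset.range a, Y i

theorem kf_tele_le (b e : ℕ → ℕ) (n : ℕ) (h : ∀ i, e i + b (i + 1) ≤ b i) :
    ∑ i ∈ Finset.range n, e i + b n ≤ b 0 := by
  induction n with
  | zero => simp
  | succ n ih =>
    have := h n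
    rw [Finset.sum_range_succ]
    omega

theorem KfGood.facts {a j k : ℕ} {α X Y : ℕ → ℕ} (h : KfGood a j k α X Y) (ha : 2 ≤ a)
    (hkj : 2 * j ≤ k) : ∃ s sx sy : ℕ, s = ∑ i ∈ Finset.range a, α (i + 1) ∧
      sx = ∑ i ∈ Finset.range a, X (i + 1) ∧ sy = ∑ i ∈ Finset.range a, Y i ∧
      s + α 0 = k ∧ α 1 ≤ s ∧ sx + sy ≤ α 1 ∧ s + X 0 + sx ≤ j ∧ X 0 + α 1 ≤ α 0 ∧
      s + α 1 + X 0 = j + sy := by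
  refine ⟨_, _, _, rfl, rfl, rfl, ?_⟩
  have h1 := h.sum
  rw [Finset.sum_range_succ'] at h1
  have h2 := kf_tele_le (fun i => α (i + 1)) (fun i => X (i + 1) + Y i) a h.step
  rw [Finset.sum_add_distrib] at h2
  have h3 : α (0 + 1) ≤ ∑ i ∈ Finset.range a, α (i + 1) :=
    Finset.single_le_sum (f := fun i => α (i + 1)) (fun _ _ => Nat.zero_le _)
      (Finset.mem_range.2 (by omega : 0 < a))
  have h4 := h.wt
  simp only [zero_add] at *
  omega

theorem KfGood.le {a j k : ℕ} {α X Y : ℕ → ℕ} (h : KfGood a j k α X Y) {i i' : ℕ} (hi : i ≤ i') :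
    α i' ≤ α i := antitone_nat_of_succ_le h.anti hi

theorem KfGood.lek {a j k : ℕ} {α X Y : ℕ → ℕ} (h : KfGood a j k α X Y) (ha : 2 ≤ a)
    (hkj : 2 * j ≤ k) (i : ℕ) : α i ≤ k := by
  obtain ⟨s, sx, sy, _, _, _, h1, _⟩ := h.facts ha hkj
  have := h.le (Nat.zero_le i)
  omega

theorem kfN_sum1 (a k : ℕ) (α X Y : ℕ → ℕ) (R : ℕ) :
    ∑ i ∈ Finset.range (R + 2), kfN a k α X Y i 1 =
      kfN a k α X Y 0 1 + X 0 + ∑ i ∈ Finset.range R, X (i + 1) := by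
  rw [Finset.sum_range_succ', Finset.sum_range_succ']
  simp only [kfN]
  ring

theorem kfN_sum2 (a k : ℕ) (α X Y : ℕ → ℕ) (R : ℕ) :
    ∑ i ∈ Finset.range (R + 2), kfN a k α X Y i 2 =
      (α 0 - α 1) + (k - α 1 - X 0) + ∑ i ∈ Finset.range R, Y i := by
  rw [Finset.sum_range_succ', Finset.sum_range_succ']
  simp only [kfN]
  ring

theorem kfN_sum3 (a k : ℕ) (α X Y : ℕ → ℕ) (R v : ℕ) :
    ∑ i ∈ Finset.range (R + 2), kfN a k α X Y i (v + 3) =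
      X (v + 1) + Y v + if v < R ∧ v + 1 < a then k - α (v + 2) - X (v + 1) - Y v else 0 := by
  induction R with
  | zero =>
    simp [Finset.sum_range_succ, kfN]
  | succ R ih =>
    rw [Finset.sum_range_succ, ih]
    simp only [kfN]
    by_cases h1 : v = R
    · subst h1
      by_cases h2 : v + 1 < a <;> simp [h2]
    · by_cases h3 : v < R
      · have : v < R + 1 := by omega
        simp [h1, h3, this]
      · have : ¬ v < R + 1 := by omega
        simp [h1, h3, this]

theorem kf_le_sum_ext (f : ℕ → ℕ) (a R : ℕ) (h : ∀ i, a ≤ i → f i = 0) :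
    ∑ i ∈ Finset.range R, f i ≤ ∑ i ∈ Finset.range a, f i := by
  rcases Nat.le_total R a with h1 | h1
  · exact Finset.sum_le_sum_of_subset (Finset.range_mono h1)
  · obtain ⟨d, rfl⟩ := Nat.exists_eq_add_of_le h1
    rw [Finset.sum_range_add]
    rw [Finset.sum_eq_zero (s := Finset.range d)]
    · omega
    · intro i _
      exact h _ (by omega)

theorem kfN_latt {a j k : ℕ} {α X Y : ℕ → ℕ} (h : KfGood a j k α X Y) (ha : 2 ≤ a)
    (hkj : 2 * j ≤ k) (r v : ℕ) :
    ∑ i ∈ Finset.range (r + 1), kfN a k α X Y i (v + 2) + α (v + 1) ≤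
      ∑ i ∈ Finset.range r, kfN a k α X Y i (v + 1) + α v := by
  obtain ⟨s, sx, sy, hs, hsx, hsy, h1, h2, h3, h4, h5, h6⟩ := h.facts ha hkj
  have hN01 : kfN a k α X Y 0 1 = 3 * k - α 0 - (α 0 - α 1) - (sx + sy) := by
    simp only [kfN, Finset.sum_add_distrib, hsx, hsy]
  have hst := h.step
  have hk := h.lek ha hkj
  rcases r with _ | r
  · simp only [zero_add, Finset.sum_range_one, Finset.sum_range_zero]
    rcases v with _ | v
    · simp only [kfN]
      have := h.anti 0
      simp only [zero_add] at *
      omega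
    · simp only [kfN]
      have := hst v
      omega
  · rcases v with _ | _ | v
    · simp only [zero_add]
      rw [kfN_sum2, Finset.sum_range_succ', hN01]
      have := kf_le_sum_ext Y a r (fun i hi => h.hY i (by omega))
      omega
    · rw [kfN_sum3]
      simp only [zero_add]
      have e0 := hst 0
      simp only [zero_add] at *
      rcases r with _ | r
      · simp [kfN]
        omega
      · rw [kfN_sum2]
        have := hk 2
        try simp only [add_assoc, Nat.reduceAdd] at *
        split_ifs <;> omega
    · rw [kfN_sum3]
      have e1 := hst (v + 1)
      have e2 := hst v
      have e3 := hk (v + 2)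
      have e4 := hk (v + 3)
      rcases r with _ | r
      · simp [kfN]
        try simp only [add_assoc, Nat.reduceAdd] at *
        omega
      · rw [kfN_sum3]
        by_cases hv : v + 1 < a
        · simp only [hv, and_true]
          by_cases hv2 : v < r
          · simp only [hv2, if_true]
            try simp only [add_assoc, Nat.reduceAdd] at *
            split_ifs <;> omega
          · have : ¬ (v + 1 < r + 1 ∧ v + 1 + 1 < a) := by omega
            simp only [hv2, this, if_false]
            try simp only [add_assoc, Nat.reduceAdd] at *
            omega
        · have : ¬ (v + 1 < r + 1 ∧ v + 1 + 1 < a) := by omega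
          simp only [this, if_false]
          try simp only [add_assoc, Nat.reduceAdd] at *
          omega

theorem kfN_col {a j k : ℕ} {α X Y : ℕ → ℕ} (h : KfGood a j k α X Y) (ha : 2 ≤ a)
    (hkj : 2 * j ≤ k) (v : ℕ) :
    ∑ i ∈ Finset.range (a + 1), kfN a k α X Y i (v + 1) = kfNu a j k v - α v := by
  obtain ⟨s, sx, sy, hs, hsx, hsy, h1, h2, h3, h4, h5, h6⟩ := h.facts ha hkj
  have hN01 : kfN a k α X Y 0 1 = 3 * k - α 0 - (α 0 - α 1) - (sx + sy) := by
    simp only [kfN, Finset.sum_add_distrib, hsx, hsy]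
  obtain ⟨n, rfl⟩ : ∃ n, a = n + 2 := ⟨a - 2, by omega⟩
  have hX := h.hX (n + 2) (le_refl _)
  have hY := h.hY (n + 1) (by omega)
  rw [Finset.sum_range_succ] at hsx hsy
  rcases v with _ | _ | v
  · simp only [zero_add]
    rw [show n + 2 + 1 = (n + 1) + 2 by omega, kfN_sum1, hN01]
    simp only [kfNu]
    simp only [if_true]
    try simp only [add_assoc, Nat.reduceAdd] at *
    omega
  · simp only [zero_add, one_add_one_eq_two]
    rw [show n + 2 + 1 = (n + 1) + 2 by omega, kfN_sum2]
    simp only [kfNu]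
    simp only [if_true, one_ne_zero, if_false]
    omega
  · rw [show n + 2 + 1 = (n + 1) + 2 by omega, kfN_sum3]
    have e1 := h.step v
    have e2 := h.lek (by omega) hkj (v + 1)
    simp only [kfNu]
    have : ¬ (v + 2 = 0) := by omega
    have : ¬ (v + 2 = 1) := by omega
    have h7 : ¬ (v + 1 + 1 = 0) := by omega
    have h8 : ¬ (v + 1 + 1 = 1) := by omega
    simp only [h7, h8, if_false]
    by_cases hv : v < n + 1
    · have h9 : v + 1 < n + 2 := by omega
      have h10 : v + 1 + 1 < n + 2 + 1 := by omega
      simp only [hv, h9, h10, and_self, if_true]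
      try simp only [add_assoc, Nat.reduceAdd] at *
      omega
    · have h10 : ¬ (v + 1 + 1 < n + 2 + 1) := by omega
      have e3 := h.hX (v + 1) (by omega)
      have e4 := h.hY v (by omega)
      simp only [hv, h10, false_and, if_false]
      omega

theorem kfN_zero {a k : ℕ} {α X Y : ℕ → ℕ} (i : ℕ) : kfN a k α X Y i 0 = 0 := by
  rcases i with _ | _ | i <;> rfl

theorem kfN_big {a j k : ℕ} {α X Y : ℕ → ℕ} (h : KfGood a j k α X Y) (ha : 2 ≤ a)
    (i v : ℕ) (hv : a + 2 ≤ v) : kfN a k α X Y i v = 0 := by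
  obtain ⟨v, rfl⟩ : ∃ w, v = w + 3 := ⟨v - 3, by omega⟩
  rcases i with _ | _ | i
  · simp only [kfN]
    rw [h.hX _ (by omega), h.hY _ (by omega)]
  · rfl
  · simp only [kfN]
    rw [if_neg]
    omega

theorem kfN_row {a j k : ℕ} {α X Y : ℕ → ℕ} (h : KfGood a j k α X Y) (ha : 2 ≤ a)
    (hkj : 2 * j ≤ k) (i : ℕ) :
    kfS (α i) (kfN a k α X Y i) (a + 1) = hookRect (3 * k) k a i := by
  obtain ⟨s, sx, sy, hs, hsx, hsy, h1, h2, h3, h4, h5, h6⟩ := h.facts ha hkj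
  have hN01 : kfN a k α X Y 0 1 = 3 * k - α 0 - (α 0 - α 1) - (sx + sy) := by
    simp only [kfN, Finset.sum_add_distrib, hsx, hsy]
  obtain ⟨n, rfl⟩ : ∃ n, a = n + 2 := ⟨a - 2, by omega⟩
  have hX := h.hX (n + 2) (le_refl _)
  have hY := h.hY (n + 1) (by omega)
  rw [Finset.sum_range_succ] at hsx hsy
  unfold kfS
  rw [show n + 2 + 1 + 1 = n + 1 + 1 + 1 + 1 by omega, Finset.sum_range_succ',
    Finset.sum_range_succ', Finset.sum_range_succ']
  rcases i with _ | _ | i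
  · have : ∑ x ∈ Finset.range (n + 1), kfN (n + 2) k α X Y 0 (x + 1 + 1 + 1) = sx + sy := by
      simp only [kfN, Finset.sum_add_distrib]
      try simp only [add_assoc, Nat.reduceAdd] at *
      omega
    rw [this]
    have h02 : kfN (n + 2) k α X Y 0 (0 + 1 + 1) = α 0 - α 1 := rfl
    have h00 : kfN (n + 2) k α X Y 0 0 = 0 := rfl
    simp only [zero_add] at *
    rw [hN01, h02, h00]
    simp only [hookRect, if_true]
    omega
  · simp [kfN, hookRect]
    omega
  · simp only [kfN, hookRect, zero_add]
    have e1 := h.step i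
    have e2 := h.lek (by omega) hkj (i + 1)
    have h7 : ¬ (i + 2 = 0) := by omega
    have h8 : ¬ (i + 1 + 1 = 0) := by omega
    simp only [h8, if_false]
    by_cases hi : i + 1 < n + 2
    · have h9 : i + 1 + 1 < n + 2 + 1 := by omega
      have h10 : i < n + 1 := by omega
      simp only [hi, h9, if_true, and_true, Finset.sum_ite_eq', Finset.mem_range, h10]
      try simp only [add_assoc, Nat.reduceAdd] at *
      omega
    · have h9 : ¬ (i + 1 + 1 < n + 2 + 1) := by omega
      simp only [hi, h9, if_false, and_false, Finset.sum_const_zero]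
      have e3 := h.zero (i + 2) (by omega)
      have e4 := h.hX (i + 1) (by omega)
      have e5 := h.hY i (by omega)
      try simp only [add_assoc, Nat.reduceAdd] at *
      omega

/-- The tableau built from the content matrix. -/
def kfT (a k : ℕ) (α X Y : ℕ → ℕ) : ℕ × ℕ → ℕ := fun p =>
  if α p.1 ≤ p.2 ∧ p.2 < hookRect (3 * k) k a p.1 then
    kfFill (α p.1) (kfN a k α X Y p.1) (a + 2) p.2 else 0

theorem kfT_rc {a j k : ℕ} {α X Y : ℕ → ℕ} (h : KfGood a j k α X Y) (ha : 2 ≤ a)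
    (hkj : 2 * j ≤ k) (i v : ℕ) :
    kfRC (hookRect (3 * k) k a) α (kfT a k α X Y) i v = kfN a k α X Y i v := by
  rw [← kfFill_count (α i) (hookRect (3 * k) k a i) a (kfN a k α X Y i) (kfN_zero i)
    (fun v hv => kfN_big h ha i v hv) (kfN_row h ha hkj i) v]
  unfold kfRC
  congr 1
  refine Finset.filter_congr fun c hc => ?_
  rw [Finset.mem_Ico] at hc
  simp only [kfT, hc, and_self, if_true]

theorem kfT_isK {a j k : ℕ} {α X Y : ℕ → ℕ} (h : KfGood a j k α X Y) (ha : 2 ≤ a)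
    (hkj : 2 * j ≤ k) :
    IsKroneckerTableau (hookRect (3 * k) k a) (kfNu a j k) α (kfT a k α X Y) := by
  obtain ⟨s, sx, sy, hs, hsx, hsy, h1, h2, h3, h4, h5, h6⟩ := h.facts ha hkj
  have hrc := kfT_rc h ha hkj
  have hk := h.lek ha hkj
  have hlam : ∀ i, a + 1 ≤ i → hookRect (3 * k) k a i = 0 := by
    intro i hi
    have e1 : i ≠ 0 := by omega
    have e2 : ¬ i < a + 1 := by omega
    simp [hookRect, e1, e2]
  have hlam1 : ∀ i, hookRect (3 * k) k a (i + 1) ≤ k := by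
    intro i
    unfold hookRect
    rw [if_neg (by omega)]
    split_ifs <;> omega
  have hT : ∀ i c, (i, c) ∈ skewCells (hookRect (3 * k) k a) α →
      kfT a k α X Y (i, c) = kfFill (α i) (kfN a k α X Y i) (a + 2) c := by
    intro i c hc
    have hc' : α i ≤ c ∧ c < hookRect (3 * k) k a i := hc
    simp [kfT, hc']
  have hcol1 : ∀ i c, (i, c) ∈ skewCells (hookRect (3 * k) k a) α →
      (i + 1, c) ∈ skewCells (hookRect (3 * k) k a) α →
      kfT a k α X Y (i, c) < kfT a k α X Y (i + 1, c) := by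
    intro i c hc hc1
    rw [hT i c hc, hT _ c hc1]
    have hc' : α i ≤ c ∧ c < hookRect (3 * k) k a i := hc
    have hc1' : α (i + 1) ≤ c ∧ c < hookRect (3 * k) k a (i + 1) := hc1
    have hck := hlam1 i
    have hia : i + 1 < a + 1 := by
      by_contra h'
      have := hlam (i + 1) (by omega)
      omega
    have hup : ¬ (i + 2 ≤ kfFill (α i) (kfN a k α X Y i) (a + 2) c) := by
      rw [kfFill_iff _ _ _ _ (i + 1) (by omega)]
      rcases i with _ | _ | i
      · have hN01 : kfN a k α X Y 0 1 = 3 * k - α 0 - (α 0 - α 1) - (sx + sy) := by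
          simp only [kfN, Finset.sum_add_distrib, hsx, hsy]
        simp only [kfS, zero_add, Finset.sum_range_succ, Finset.sum_range_zero, hN01]
        omega
      · simp only [kfS, zero_add, Finset.sum_range_succ, Finset.sum_range_zero, kfN]
        have := hk 1
        simp only [zero_add] at *
        omega
      · unfold kfS
        rw [Finset.sum_range_succ', Finset.sum_range_succ', Finset.sum_range_succ',
          Finset.sum_range_succ]
        have e1 := h.step i
        have e2 := hk (i + 1)
        have e3 : i + 1 < a := by omega
        simp only [kfN, e3, and_self, if_true, zero_add]
        simp only [add_assoc, Nat.reduceAdd] at *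
        omega
    have hdn : i + 2 ≤ kfFill (α (i + 1)) (kfN a k α X Y (i + 1)) (a + 2) c := by
      rw [kfFill_iff _ _ _ _ (i + 1) (by omega)]
      rcases i with _ | i
      · simp only [kfS, zero_add, Finset.sum_range_succ, Finset.sum_range_zero, kfN]
        simp only [zero_add] at *
        omega
      · unfold kfS
        rw [Finset.sum_range_succ', Finset.sum_range_succ', Finset.sum_range_succ']
        have e1 := h.step i
        have e3 : i + 1 < a := by omega
        simp only [kfN, zero_add]
        rw [Finset.sum_eq_zero]
        · simp only [add_assoc, Nat.reduceAdd] at *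
          omega
        · intro x hx
          have hx := Finset.mem_range.1 hx
          rw [if_neg]
          omega
    omega
  refine ⟨?_, ?_, ?_, ?_, ?_, ?_, ?_, ?_⟩
  · intro i
    have e1 := hk i
    simp only [hookRect, kfNu]
    have e2 := h.zero i
    split_ifs <;> omega
  · intro p hp
    have hp' : ¬ (α p.1 ≤ p.2 ∧ p.2 < hookRect (3 * k) k a p.1) := hp
    simp [kfT, hp']
  · rintro ⟨i, c⟩ hp
    rw [hT i c hp, show (1 : ℕ) = 0 + 1 from rfl, kfFill_iff _ _ _ _ 0 (by omega)]
    simp only [kfS, zero_add, Finset.sum_range_one, kfN_zero, add_zero]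
    exact hp.1
  · intro i c d hc hd hcd
    rw [hT i c hc, hT i d hd]
    exact kfFill_mono _ _ _ hcd
  · intro i i' c hc hc' hlt
    have hmid : ∀ m, i ≤ m → m ≤ i' → (m, c) ∈ skewCells (hookRect (3 * k) k a) α := by
      intro m hm hm'
      have e1 : α i ≤ c ∧ c < hookRect (3 * k) k a i := hc
      have e2 : α i' ≤ c ∧ c < hookRect (3 * k) k a i' := hc'
      have e3 := h.le hm
      refine ⟨?_, ?_⟩
      · simp only
        omega
      · simp only
        have e4 := hlam i'
        have e5 : i' < a + 1 := by
          by_contra h'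
          have := e4 (by omega)
          omega
        revert e1 e2
        simp only [hookRect]
        split_ifs <;> omega
    obtain ⟨d, rfl⟩ := Nat.exists_eq_add_of_lt hlt
    clear hc' hlt
    induction d with
    | zero => exact hcol1 i c hc (hmid _ (by omega) (by omega))
    | succ d ih =>
      refine lt_trans (ih fun m hm hm' => hmid m hm (by omega)) ?_
      exact hcol1 (i + d + 1) c (hmid _ (by omega) (by omega)) (hmid _ (by omega) (by omega))
  · intro v
    rw [kf_ec_all _ _ _ (a + 1) _ hlam]
    simp only [hrc]
    exact kfN_col h ha hkj v
  · apply kf_latt_bwd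
    intro r v
    simp only [hrc]
    exact kfN_latt h ha hkj r v
  · have := h.anti 0
    rcases Nat.eq_or_lt_of_le this with h' | h'
    · exact Or.inl h'.symm
    · refine Or.inr ⟨h', Or.inr ?_⟩
      rw [kf_ec_row, hrc]
      rfl

theorem kf_rc_pos (lam α : ℕ → ℕ) (T : ℕ × ℕ → ℕ) (i c : ℕ) (hc : (i, c) ∈ skewCells lam α) :
    1 ≤ kfRC lam α T i (T (i, c)) := by
  unfold kfRC
  rw [Nat.one_le_iff_ne_zero, Finset.card_ne_zero]
  refine ⟨c, ?_⟩
  have hc' : α i ≤ c ∧ c < lam i := hc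
  simp [hc']

theorem kf_rc_zero (lam α : ℕ → ℕ) (T : ℕ × ℕ → ℕ) (i v : ℕ)
    (h : ∀ c, (i, c) ∈ skewCells lam α → T (i, c) ≠ v) : kfRC lam α T i v = 0 := by
  unfold kfRC
  rw [Finset.card_eq_zero, Finset.filter_eq_empty_iff]
  intro c hc
  exact h c (Finset.mem_Ico.1 hc)

theorem kf_rc_sum (lam α : ℕ → ℕ) (T : ℕ × ℕ → ℕ) (i K : ℕ)
    (h : ∀ c, (i, c) ∈ skewCells lam α → T (i, c) < K) :
    ∑ v ∈ Finset.range K, kfRC lam α T i v = lam i - α i := by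
  rw [← Nat.card_Ico]
  symm
  apply Finset.card_eq_sum_card_fiberwise
  intro c hc
  simp only [Finset.coe_range, Set.mem_Iio]
  exact h c (Finset.mem_Ico.1 hc)

theorem kf_forward (a j k : ℕ) (ha : 2 ≤ a) (hkj : 2 * j ≤ k) (α : ℕ → ℕ) (T : ℕ × ℕ → ℕ)
    (hanti : ∀ i, α (i + 1) ≤ α i) (hzero : ∀ i, a + 1 ≤ i → α i = 0)
    (hsum : ∑ i ∈ Finset.range (a + 1), α i = k)
    (hK : IsKroneckerTableau (hookRect (3 * k) k a) (kfNu a j k) α T)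
    (N : ℕ → ℕ → ℕ) (hN : N = kfRC (hookRect (3 * k) k a) α T)
    (X Y : ℕ → ℕ) (hXd : ∀ i, X i = N (i + 1) 1) (hYd : ∀ i, Y i = N (i + 2) 2) :
    KfGood a j k α X Y ∧ ∀ i v, N i v = kfN a k α X Y i v := by
  obtain ⟨hsub, hout, hpos, hrow, hcol, htype, hlatt, hcond⟩ := hK
  have hlam : ∀ i, a + 1 ≤ i → hookRect (3 * k) k a i = 0 := by
    intro i hi
    have e1 : i ≠ 0 := by omega
    have e2 : ¬ i < a + 1 := by omega
    simp [hookRect, e1, e2]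
  have hlam1 : ∀ i, i < a → hookRect (3 * k) k a (i + 1) = k := by
    intro i hi
    unfold hookRect
    rw [if_neg (by omega), if_pos (by omega)]
  have hL := kf_latt_fwd _ _ _ hrow hlatt
  have hC : ∀ v, ∑ i ∈ Finset.range (a + 1), N i (v + 1) = kfNu a j k v - α v := by
    intro v
    rw [← htype v, kf_ec_all _ _ _ (a + 1) _ hlam, hN]
  rw [kf_ec_row, kf_ec_row] at hcond
  rw [← hN] at hL hcond
  have hP : ∀ i c, (i, c) ∈ skewCells (hookRect (3 * k) k a) α → 1 ≤ N i (T (i, c)) := by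
    intro i c hc
    rw [hN]
    exact kf_rc_pos _ _ _ _ _ hc
  have hZ : ∀ i v, (∀ c, (i, c) ∈ skewCells (hookRect (3 * k) k a) α → T (i, c) ≠ v) →
      N i v = 0 := by
    intro i v h
    rw [hN]
    exact kf_rc_zero _ _ _ _ _ h
  have hSm : ∀ i K, (∀ c, (i, c) ∈ skewCells (hookRect (3 * k) k a) α → T (i, c) < K) →
      ∑ v ∈ Finset.range K, N i v = hookRect (3 * k) k a i - α i := by
    intro i K h
    rw [hN]
    exact kf_rc_sum _ _ _ _ _ h
  clear hN
  have hN0 : ∀ i, N i 0 = 0 := by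
    intro i
    apply hZ
    intro c hc
    have := hpos _ hc
    omega
  have hNout : ∀ i v, a + 1 ≤ i → N i v = 0 := by
    intro i v hi
    apply hZ
    intro c hc
    have hc' : α i ≤ c ∧ c < hookRect (3 * k) k a i := hc
    have := hlam i hi
    omega
  have hbig : ∀ i v, a + 1 ≤ v → N i (v + 1) = 0 := by
    intro i v hv
    by_cases hi : a + 1 ≤ i
    · exact hNout i _ hi
    · have h1 := hC v
      have h2 : kfNu a j k v = 0 := by
        unfold kfNu
        rw [if_neg (by omega), if_neg (by omega), if_neg (by omega)]
      rw [h2, Nat.zero_sub] at h1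
      exact Finset.sum_eq_zero_iff.1 h1 i (Finset.mem_range.2 (by omega))
  have hTle : ∀ i c, (i, c) ∈ skewCells (hookRect (3 * k) k a) α → T (i, c) ≤ a + 1 := by
    intro i c hc
    by_contra h
    have h1 := hP i c hc
    have h2 := hbig i (T (i, c) - 1) (by omega)
    rw [show T (i, c) - 1 + 1 = T (i, c) by omega] at h2
    omega
  have hB' : ∀ d i, i + d = a → 1 ≤ i → ∀ c, (i, c) ∈ skewCells (hookRect (3 * k) k a) α →
      T (i, c) ≤ i + 1 := by
    intro d
    induction d with
    | zero =>
      intro i hi _ c hc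
      have := hTle i c hc
      omega
    | succ d ih =>
      intro i hi h1 c hc
      have hc' : α i ≤ c ∧ c < hookRect (3 * k) k a i := hc
      have e1 := hlam1 (i - 1) (by omega)
      rw [show i - 1 + 1 = i by omega] at e1
      have e2 := hlam1 i (by omega)
      have e3 := hanti i
      have hc1 : (i + 1, c) ∈ skewCells (hookRect (3 * k) k a) α := by
        constructor
        · simp only
          omega
        · simp only
          omega
      have e4 := ih (i + 1) (by omega) (by omega) c hc1
      have e5 := hcol i (i + 1) c hc hc1 (by omega)
      omega
  have hB : ∀ i, 1 ≤ i → ∀ c, (i, c) ∈ skewCells (hookRect (3 * k) k a) α →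
      T (i, c) ≤ i + 1 := by
    intro i hi c hc
    by_cases hia : i ≤ a
    · exact hB' (a - i) i (by omega) hi c hc
    · have := hTle i c hc
      omega
  have hBN : ∀ i v, 1 ≤ i → i + 2 ≤ v → N i v = 0 := by
    intro i v hi hv
    apply hZ
    intro c hc
    have := hB i hi c hc
    omega
  have hM : ∀ d i, i + d = a + 1 → ∀ u, u < i →
      k ≤ ∑ r ∈ Finset.range i, N r (u + 1) + α u := by
    intro d
    induction d with
    | zero =>
      intro i hi u hu
      have hi : i = a + 1 := by omega
      subst hi
      rw [hC u]
      have h1 := (hsub u).2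
      have h2 : k ≤ kfNu a j k u := by
        unfold kfNu
        split_ifs <;> omega
      omega
    | succ d ih =>
      intro i hi u hu
      have h1 := ih (i + 1) (by omega) (u + 1) (by omega)
      have h2 := hL i u
      simp only [add_assoc, Nat.reduceAdd] at *
      omega
  have hD : ∀ i u, i ≤ a → 2 ≤ u → u < i → N i (u + 1) = 0 := by
    intro i u hi hu hui
    have h1 := hM (a + 1 - i) i (by omega) u hui
    have h2 := hC u
    have h3 : kfNu a j k u = k := by
      unfold kfNu
      rw [if_neg (by omega), if_neg (by omega), if_pos (by omega)]
    have h4 : ∑ r ∈ Finset.range (i + 1), N r (u + 1) ≤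
        ∑ r ∈ Finset.range (a + 1), N r (u + 1) :=
      Finset.sum_le_sum_of_subset (Finset.range_mono (by omega))
    rw [Finset.sum_range_succ] at h4
    have h5 := (hsub u).2
    omega
  have hrowz : ∀ i v, v ≠ i → N (i + 2) (v + 3) = 0 := by
    intro i v hv
    by_cases hi : a + 1 ≤ i + 2
    · exact hNout _ _ hi
    · rcases Nat.lt_or_gt_of_ne hv with h | h
      · exact hD (i + 2) (v + 2) (by omega) (by omega) (by omega)
      · exact hBN _ _ (by omega) (by omega)
  have hrowsum : ∀ i, i + 1 < a → X (i + 1) + Y i + N (i + 2) (i + 3) = k - α (i + 2) := by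
    intro i hi
    have h1 := hSm (i + 2) (i + 1 + 1 + 1 + 1) (fun c hc => by
      have := hB (i + 2) (by omega) c hc
      omega)
    rw [hlam1 (i + 1) hi, Finset.sum_range_succ', Finset.sum_range_succ', Finset.sum_range_succ',
      Finset.sum_range_succ, Finset.sum_eq_zero] at h1
    · rw [hXd, hYd]
      simp only [hN0] at h1
      simp only [add_assoc, Nat.reduceAdd, zero_add] at *
      omega
    · intro x hx
      have hx := Finset.mem_range.1 hx
      exact hrowz i x (by omega)
  have hrow1 : X 0 + N 1 2 = k - α 1 := by
    have h1 := hSm 1 3 (fun c hc => by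
      have := hB 1 (by omega) c hc
      omega)
    rw [hlam1 0 (by omega)] at h1
    simp only [Finset.sum_range_succ, Finset.sum_range_zero, hN0] at h1
    rw [hXd]
    simp only [zero_add] at *
    omega
  have hX : ∀ i, a ≤ i → X i = 0 := by
    intro i hi
    rw [hXd]
    exact hNout _ _ (by omega)
  have hY : ∀ i, a ≤ i + 1 → Y i = 0 := by
    intro i hi
    rw [hYd]
    exact hNout _ _ (by omega)
  have hN03 : ∀ v, N 0 (v + 3) = X (v + 1) + Y v := by
    intro v
    by_cases hv : v + 1 < a
    · have h1 := hC (v + 2)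
      have h3 : kfNu a j k (v + 2) = k := by
        unfold kfNu
        rw [if_neg (by omega), if_neg (by omega), if_pos (by omega)]
      rw [Finset.sum_range_succ', Finset.sum_eq_single (v + 1), h3] at h1
      · have h2 := hrowsum v hv
        simp only [add_assoc, Nat.reduceAdd] at *
        omega
      · intro i _ hne
        rcases i with _ | i
        · exact hBN _ _ (by omega) (by omega)
        · exact hrowz i v (by omega)
      · intro h
        exact absurd (Finset.mem_range.2 (by omega)) h
    · rw [hX _ (by omega), hY _ (by omega)]
      exact hbig 0 (v + 2) (by omega)
  have hstep : ∀ i, X (i + 1) + Y i + α (i + 2) ≤ α (i + 1) := by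
    intro i
    have h1 := hL 0 (i + 1)
    simp only [zero_add, Finset.sum_range_one, Finset.sum_range_zero] at h1
    rw [← hN03]
    exact h1
  have hN02 : N 0 2 + α 1 ≤ α 0 := by
    have h1 := hL 0 0
    simpa using h1
  obtain ⟨s, hs⟩ : ∃ s, s = ∑ i ∈ Finset.range a, α (i + 1) := ⟨_, rfl⟩
  obtain ⟨sx, hsx⟩ : ∃ s, s = ∑ i ∈ Finset.range a, X (i + 1) := ⟨_, rfl⟩
  obtain ⟨sy, hsy⟩ : ∃ s, s = ∑ i ∈ Finset.range a, Y i := ⟨_, rfl⟩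
  have hs0 : s + α 0 = k := by
    rw [← hsum, Finset.sum_range_succ', hs]
  have hs1 : α 1 ≤ s := by
    rw [hs]
    exact Finset.single_le_sum (f := fun i => α (i + 1)) (fun _ _ => Nat.zero_le _)
      (Finset.mem_range.2 (by omega : 0 < a))
  have hte : sx + sy ≤ α 1 := by
    have h2 := kf_tele_le (fun i => α (i + 1)) (fun i => X (i + 1) + Y i) a hstep
    rw [Finset.sum_add_distrib, ← hsx, ← hsy] at h2
    simp only [zero_add] at h2
    omega
  have hr0 : N 0 1 + N 0 2 + (sx + sy) = 3 * k - α 0 := by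
    have h1 := hSm 0 (a + 1 + 1 + 1) (fun c hc => by
      have := hTle 0 c hc
      omega)
    rw [Finset.sum_range_succ', Finset.sum_range_succ', Finset.sum_range_succ'] at h1
    simp only [hN03, hN0, Finset.sum_add_distrib, ← hsx, ← hsy, zero_add, Nat.reduceAdd] at h1
    have : hookRect (3 * k) k a 0 = 3 * k := rfl
    omega
  have hc1 : N 0 1 + X 0 + sx = 2 * k + j - α 0 := by
    have h1 := hC 0
    have h2 : kfNu a j k 0 = 2 * k + j := rfl
    rw [Finset.sum_range_succ', h2] at h1
    simp only [zero_add, ← hXd] at h1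
    have h3 := Finset.sum_range_succ X a
    rw [Finset.sum_range_succ', hX a (le_refl _)] at h3
    omega
  have hX0 : X 0 = N 1 1 := hXd 0
  have hkey : N 0 2 = α 0 - α 1 := by
    rcases hcond with h | ⟨h1, h | h⟩
    · omega
    · omega
    · exact h
  have hwt : s + α 1 + X 0 = j + sy := by omega
  refine ⟨⟨hanti, hzero, hsum, hX, hY, hstep, ?_⟩, ?_⟩
  · rw [← hs, ← hsy]
    exact hwt
  · intro i v
    rcases i with _ | _ | i
    · rcases v with _ | _ | _ | v
      · exact hN0 0
      · simp only [kfN, zero_add, Finset.sum_add_distrib, ← hsx, ← hsy]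
        omega
      · exact hkey
      · exact hN03 v
    · rcases v with _ | _ | _ | v
      · exact hN0 1
      · exact (hXd 0).symm
      · simp only [kfN, zero_add, Nat.reduceAdd]
        omega
      · exact hBN _ _ (by omega) (by omega)
    · rcases v with _ | _ | _ | v
      · exact hN0 _
      · exact (hXd _).symm
      · exact (hYd _).symm
      · simp only [kfN]
        by_cases hv : v = i
        · subst hv
          by_cases hva : v + 1 < a
          · have := hrowsum v hva
            simp only [hva, and_self, if_true]
            simp only [add_assoc, Nat.reduceAdd] at *
            omega
          · simp only [hva, and_false, if_false]
            exact hNout _ _ (by omega)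
        · simp only [hv, false_and, if_false]
          exact hrowz i v hv

/-- The parts `α` reconstructed from the parameters. -/
def kfB (a : ℕ) (E X Y : ℕ → ℕ) (i : ℕ) : ℕ := ∑ l ∈ Finset.Ico i a, (E l + X (l + 1) + Y l)

/-- The partition `α` reconstructed from the parameters. -/
def kfA (a k : ℕ) (E X Y : ℕ → ℕ) : ℕ → ℕ
  | 0 => k - ∑ i ∈ Finset.range a, kfB a E X Y i
  | i + 1 => kfB a E X Y i

theorem kfB_step (a : ℕ) (E X Y : ℕ → ℕ) (i : ℕ) (hi : i < a) :
    kfB a E X Y i = E i + X (i + 1) + Y i + kfB a E X Y (i + 1) := by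
  unfold kfB
  rw [Finset.sum_eq_sum_Ico_succ_bot hi]

theorem kfB_zero (a : ℕ) (E X Y : ℕ → ℕ) (i : ℕ) (hi : a ≤ i) : kfB a E X Y i = 0 := by
  unfold kfB
  rw [Finset.Ico_eq_empty_of_le hi, Finset.sum_empty]

theorem kfA_unique (a : ℕ) (b E X Y : ℕ → ℕ) (hz : ∀ i, a ≤ i → b i = 0)
    (h : ∀ i, i < a → b i = E i + X (i + 1) + Y i + b (i + 1)) (i : ℕ) :
    b i = kfB a E X Y i := by
  by_cases hi : a ≤ i
  · rw [hz i hi, kfB_zero _ _ _ _ _ hi]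
  · have key : ∀ d i, i + d = a → b i = kfB a E X Y i := by
      intro d
      induction d with
      | zero => intro i hi; rw [hz i (by omega), kfB_zero _ _ _ _ _ (by omega)]
      | succ d ih =>
        intro i hi
        rw [h i (by omega), kfB_step _ _ _ _ _ (by omega), ih (i + 1) (by omega)]
    exact key (a - i) i (by omega)

theorem kf_good_of_Q (a j k : ℕ) (ha : 2 ≤ a) (hkj : 2 * j ≤ k) (E X Y : ℕ → ℕ)
    (hQ : kfQ a j (E, X, Y)) : KfGood a j k (kfA a k E X Y) X Y := by
  obtain ⟨h1, h2, h3, h4⟩ := hQ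
  simp only at h1 h2 h3 h4
  have hw := kf_weight a E X Y (kfB a E X Y) (h2 a (le_refl _)) (kfB_zero _ _ _ _ _ (le_refl _))
    (fun i hi => kfB_step _ _ _ _ _ hi)
  rw [h4] at hw
  have hstep : ∀ i, X (i + 1) + Y i + kfB a E X Y (i + 1) ≤ kfB a E X Y i := by
    intro i
    by_cases hi : i < a
    · rw [kfB_step _ _ _ _ i hi]
      omega
    · rw [kfB_zero _ _ _ _ _ (by omega), h2 _ (by omega), h3 _ (by omega)]
      omega
  have hte := kf_tele_le (kfB a E X Y) (fun i => X (i + 1) + Y i) a hstep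
  rw [Finset.sum_add_distrib] at hte
  have hs1 : kfB a E X Y 0 ≤ ∑ i ∈ Finset.range a, kfB a E X Y i :=
    Finset.single_le_sum (f := fun i => kfB a E X Y i) (fun _ _ => Nat.zero_le _)
      (Finset.mem_range.2 (by omega : 0 < a))
  refine ⟨?_, ?_, ?_, h2, h3, hstep, hw⟩
  · intro i
    rcases i with _ | i
    · simp only [kfA, zero_add]
      omega
    · have := hstep i
      simp only [kfA]
      omega
  · intro i hi
    obtain ⟨i, rfl⟩ : ∃ m, i = m + 1 := ⟨i - 1, by omega⟩
    exact kfB_zero _ _ _ _ _ (by omega)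
  · rw [Finset.sum_range_succ']
    simp only [kfA]
    omega

theorem kf_Q_of_good (a j k : ℕ) (α X Y E : ℕ → ℕ) (h : KfGood a j k α X Y)
    (hE : ∀ i, E i = α (i + 1) - α (i + 2) - X (i + 1) - Y i) :
    kfQ a j (E, X, Y) ∧ α = kfA a k E X Y := by
  have hst : ∀ i, i < a → α (i + 1) = E i + X (i + 1) + Y i + α (i + 1 + 1) := by
    intro i _
    have := h.step i
    rw [hE]
    simp only [add_assoc, Nat.reduceAdd] at *
    omega
  have hw := kf_weight a E X Y (fun i => α (i + 1)) (h.hX a (le_refl _)) (h.zero _ (le_refl _)) hst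
  have hwt := h.wt
  refine ⟨⟨?_, h.hX, h.hY, ?_⟩, ?_⟩
  · intro i hi
    have := h.zero (i + 1) (by omega)
    simp only [hE]
    omega
  · simp only [zero_add] at *
    omega
  · have hb : ∀ i, α (i + 1) = kfB a E X Y i :=
      kfA_unique a (fun i => α (i + 1)) E X Y (fun i hi => h.zero _ (by omega)) hst
    funext i
    rcases i with _ | i
    · simp only [kfA, ← hb]
      have := h.sum
      rw [Finset.sum_range_succ'] at this
      omega
    · exact hb i

/-- The parameter map. -/
def kfMap (a k : ℕ) (x : (ℕ → ℕ) × (ℕ × ℕ → ℕ)) : (ℕ → ℕ) × (ℕ → ℕ) × (ℕ → ℕ) :=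
  (fun i => x.1 (i + 1) - x.1 (i + 2) - kfRC (hookRect (3 * k) k a) x.1 x.2 (i + 2) 1 -
      kfRC (hookRect (3 * k) k a) x.1 x.2 (i + 2) 2,
    fun i => kfRC (hookRect (3 * k) k a) x.1 x.2 (i + 1) 1,
    fun i => kfRC (hookRect (3 * k) k a) x.1 x.2 (i + 2) 2)

/-- For `k ≥ 2j`, the total number of Kronecker tableaux of shape `(3k, k^a)/α` and
type `(2k+j, 2k−j, k^{a−1})/α`, summed over all partitions `α ⊢ k` with at most
`a+1` parts, equals the number of coloured partitions of `j` with parts in `C_a`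
(in particular it is independent of `k`). -/
theorem kroneckerTableaux_family3_count (a j k : ℕ) (ha : 2 ≤ a) (hk1 : 1 ≤ k)
    (hkj : 2 * j ≤ k) :
    Nat.card {x : (ℕ → ℕ) × (ℕ × ℕ → ℕ) //
      (∀ i, x.1 (i + 1) ≤ x.1 i) ∧
      (∀ i, a + 1 ≤ i → x.1 i = 0) ∧
      (∑ i ∈ Finset.range (a + 1), x.1 i) = k ∧
      IsKroneckerTableau (hookRect (3 * k) k a)
        (fun t => if t = 0 then 2 * k + j else if t = 1 then 2 * k - j
          else if t < a + 1 then k else 0)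
        x.1 x.2} =
    colouredC a j := by
  change Nat.card {x : (ℕ → ℕ) × (ℕ × ℕ → ℕ) //
      (∀ i, x.1 (i + 1) ≤ x.1 i) ∧
      (∀ i, a + 1 ≤ i → x.1 i = 0) ∧
      (∑ i ∈ Finset.range (a + 1), x.1 i) = k ∧
      IsKroneckerTableau (hookRect (3 * k) k a) (kfNu a j k) x.1 x.2} = colouredC a j
  have hcol : colouredC a j = Nat.card {q // kfQ a j q} := by
    obtain ⟨n, rfl⟩ : ∃ n, a = n + 2 := ⟨a - 2, by omega⟩
    exact kf_coloured n j
  rw [hcol]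
  have hfwd : ∀ x : (ℕ → ℕ) × (ℕ × ℕ → ℕ), ((∀ i, x.1 (i + 1) ≤ x.1 i) ∧
      (∀ i, a + 1 ≤ i → x.1 i = 0) ∧
      (∑ i ∈ Finset.range (a + 1), x.1 i) = k ∧
      IsKroneckerTableau (hookRect (3 * k) k a) (kfNu a j k) x.1 x.2) →
      kfQ a j (kfMap a k x) ∧
      x.1 = kfA a k (kfMap a k x).1 (kfMap a k x).2.1 (kfMap a k x).2.2 ∧
      ∀ i v, kfRC (hookRect (3 * k) k a) x.1 x.2 i v =
        kfN a k x.1 (kfMap a k x).2.1 (kfMap a k x).2.2 i v := by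
    rintro x ⟨h1, h2, h3, h4⟩
    have h := kf_forward a j k ha hkj x.1 x.2 h1 h2 h3 h4 _ rfl (kfMap a k x).2.1
      (kfMap a k x).2.2 (fun _ => rfl) (fun _ => rfl)
    have h' := kf_Q_of_good a j k x.1 (kfMap a k x).2.1 (kfMap a k x).2.2 (kfMap a k x).1 h.1
      (fun _ => rfl)
    exact ⟨h'.1, h'.2, h.2⟩
  refine Nat.card_eq_of_bijective (fun x => ⟨kfMap a k x.1, (hfwd x.1 x.2).1⟩) ⟨?_, ?_⟩
  · rintro ⟨⟨α, T⟩, hx⟩ ⟨⟨β, U⟩, hy⟩ heq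
    have heq : kfMap a k (α, T) = kfMap a k (β, U) := congrArg Subtype.val heq
    obtain ⟨_, hA, hN⟩ := hfwd _ hx
    obtain ⟨_, hA', hN'⟩ := hfwd _ hy
    rw [heq] at hA hN
    simp only at hA hA' hN hN'
    have hαβ : α = β := hA.trans hA'.symm
    subst hαβ
    have hTU : T = U := by
      obtain ⟨_, _, _, _, ho, _, hr, _⟩ := hx
      obtain ⟨_, _, _, _, ho', _, hr', _⟩ := hy
      funext ⟨i, c⟩
      by_cases hc : (i, c) ∈ skewCells (hookRect (3 * k) k a) α
      · refine kf_row_unique (α i) (hookRect (3 * k) k a i) (fun c => T (i, c))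
          (fun c => U (i, c)) ?_ ?_ ?_ c hc.1 hc.2
        · intro c d h1 h2 h3
          exact hr i c d ⟨h1, lt_of_le_of_lt h3 h2⟩ ⟨le_trans h1 h3, h2⟩ h3
        · intro c d h1 h2 h3
          exact hr' i c d ⟨h1, lt_of_le_of_lt h3 h2⟩ ⟨le_trans h1 h3, h2⟩ h3
        · intro v
          exact (hN i v).trans (hN' i v).symm
      · exact (ho (i, c) hc).trans (ho' (i, c) hc).symm
    subst hTU
    rfl
  · rintro ⟨⟨E, X, Y⟩, hQ⟩
    have hg := kf_good_of_Q a j k ha hkj E X Y hQ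
    have hrc := kfT_rc hg ha hkj
    refine ⟨⟨(kfA a k E X Y, kfT a k (kfA a k E X Y) X Y), hg.anti, hg.zero, hg.sum,
      kfT_isK hg ha hkj⟩, ?_⟩
    apply Subtype.ext
    simp only [kfMap, hrc, Prod.mk.injEq]
    have hXX : ∀ i, kfN a k (kfA a k E X Y) X Y (i + 1) 1 = X i := by
      intro i
      rcases i with _ | i <;> rfl
    refine ⟨?_, funext hXX, rfl⟩
    funext i
    change kfB a E X Y i - kfB a E X Y (i + 1) - X (i + 1) - Y i = E i
    by_cases hi : i < a
    · rw [kfB_step a E X Y i hi]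
      omega
    · have h1 : E i = 0 := hQ.1 i (by omega)
      rw [kfB_zero a E X Y i (by omega), h1]
      omega
end
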